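/- Let V be a complex inner product space of dimension M ≥ 5 with a fixed orthonormal basis e_1, …, e_M, and let N = 3. Then the single occupancy subspace 𝒮 ⊆ ⋀³V is universal: for every ψ ∈ ⋀³V there exists a unitary operator U on V such that (⋀³U) ψ ∈ 𝒮. -/

import Mathlib

open ExteriorAlgebra Finset

noncomputable section

/-- The single-particle Hilbert space: `ℂ^M` with its standard inner product. -/
abbrev V (M : ℕ) : Type := EuclideanSpace ℂ (Fin M)

/-- The fixed orthonormal basis vector `e_n` (1-indexed, `1 ≤ n ≤ M`);
out-of-range indices give `0`. -/
def stdVec (M n : ℕ) : V M :=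
  if h : 1 ≤ n ∧ n ≤ M then EuclideanSpace.single (⟨n - 1, by omega⟩ : Fin M) 1 else 0

/-- The wedge `e_{i 0} ∧ ⋯ ∧ e_{i (N-1)}` in the exterior algebra of `V M`. -/
def wedge (M N : ℕ) (i : Fin N → ℕ) : ExteriorAlgebra ℂ (V M) :=
  ExteriorAlgebra.ιMulti ℂ N fun j => stdVec M (i j)

/-- `i` enumerates a strictly increasing sequence of indices in `{1, …, M}`. -/
def IsBasisIndex (M N : ℕ) (i : Fin N → ℕ) : Prop :=
  StrictMono i ∧ ∀ j, 1 ≤ i j ∧ i j ≤ M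

/-- Single occupancy: no two of the indices lie in the same standard pair
`{2k-1, 2k}` (the pair of `n` is `(n+1)/2`). -/
def SingleOcc (N : ℕ) (i : Fin N → ℕ) : Prop :=
  ∀ j k : Fin N, j ≠ k → (i j + 1) / 2 ≠ (i k + 1) / 2

/-- The single occupancy subspace `𝒮 ⊆ ⋀^N V`: the span of all basic single
occupancy vectors. -/
def SOV (M N : ℕ) : Submodule ℂ (ExteriorAlgebra ℂ (V M)) :=
  Submodule.span ℂ
    {x | ∃ i : Fin N → ℕ, IsBasisIndex M N i ∧ SingleOcc N i ∧ x = wedge M N i}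

/-- The exterior power of a unitary operator `U` on `V M`, acting on the whole
exterior algebra (on `⋀^N V` it acts as `⋀^N U`). -/
def luMap (M : ℕ) (U : V M ≃ₗᵢ[ℂ] V M) :
    ExteriorAlgebra ℂ (V M) →ₐ[ℂ] ExteriorAlgebra ℂ (V M) :=
  ExteriorAlgebra.map U.toLinearEquiv.toLinearMap

open MeasureTheory in
theorem integral_box_partial_eq_zero {κ : Type*} [Fintype κ] [DecidableEq κ]
    (f : (κ → ℝ) → ℝ) (hf : ContDiff ℝ 1 f) (p : κ)
    (hface : ∀ x, f (Function.update x p 1) = f (Function.update x p 0)) :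
    ∫ x in Set.Icc (0 : κ → ℝ) 1, fderiv ℝ f x (Pi.single p 1) = 0 := by
  obtain ⟨n, hn⟩ : ∃ n, Fintype.card κ = n + 1 :=
    Nat.exists_eq_succ_of_ne_zero (Fintype.card_pos_iff.2 ⟨p⟩).ne'
  let e : κ ≃ Fin (n + 1) := Fintype.equivFinOfCardEq hn
  let eL : (κ → ℝ) ≃L[ℝ] (Fin (n + 1) → ℝ) := ContinuousLinearEquiv.piCongrLeft ℝ (fun _ => ℝ) e
  have heL : ∀ x i, eL x (e i) = x i := fun x i => by
    exact Equiv.piCongrLeft_apply_apply (fun _ => ℝ) e x i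
  have heLs : ∀ x i, eL.symm x i = x (e i) := fun x i => by
    rw [← heL (eL.symm x) i, eL.apply_symm_apply]
  have hc := hf.continuous_fderiv one_ne_zero
  have h := integral_divergence_of_hasFDerivAt_off_countable_of_equiv (F := κ → ℝ) eL
    (fun x y => by
      constructor
      · intro h i
        simpa [heL] using h (e i)
      · intro h i
        obtain ⟨i, rfl⟩ := e.surjective i
        simpa [heL] using h i)
    (volume_measurePreserving_piCongrLeft (fun _ => ℝ) e)
    (fun i => if i = e p then f else 0) (fun i x => if i = e p then fderiv ℝ f x else 0)
    ∅ Set.countable_empty 0 1 zero_le_one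
    (fun i => by
      split_ifs
      · exact hf.continuous.continuousOn
      · exact continuousOn_const)
    (fun x _ i => by
      split_ifs
      · exact (hf.differentiable one_ne_zero x).hasFDerivAt
      · exact hasFDerivAt_const _ _)
    (fun x => fderiv ℝ f x (Pi.single p 1))
    (fun x => by
      rw [Finset.sum_eq_single (e p)]
      · rw [if_pos rfl]
        congr 1
        ext j
        simp [heLs, Pi.single_apply]
      · intro b _ hb
        simp [hb]
      · simp)
    ((hc.clm_apply continuous_const).continuousOn.integrableOn_compact isCompact_Icc)
  rw [h, Finset.sum_eq_zero]
  intro i _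
  rw [sub_eq_zero]
  obtain ⟨i, rfl⟩ := e.surjective i
  by_cases hi : e i = e p
  · obtain rfl := e.injective hi
    have key : ∀ (c : ℝ) (x : Fin n → ℝ), eL.symm ((e i).insertNth c x) =
        Function.update (eL.symm ((e i).insertNth 0 x)) i c := by
      intro c x
      ext j
      rw [heLs, Function.update_apply]
      split_ifs with hj
      · simp [hj]
      · rw [heLs]
        obtain ⟨k, hk⟩ := Fin.exists_succAbove_eq (fun h => hj (e.injective h) : e j ≠ e i)
        rw [← hk]
        simp
    simp only [if_true, heL]
    congr 1
    ext x
    change f (eL.symm ((e i).insertNth 1 x)) = f (eL.symm ((e i).insertNth 0 x))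
    rw [key 1, key 0, hface]
    simp
  · simp [hi]

/-- The partial derivative of `f` in the coordinate direction `p`. -/
def pderivAt {κ E : Type*} [Fintype κ] [DecidableEq κ] [NormedAddCommGroup E] [NormedSpace ℝ E]
    (p : κ) (f : (κ → ℝ) → E) (x : κ → ℝ) : E :=
  fderiv ℝ f x (Pi.single p 1)

section Partial

variable {κ E : Type*} [Fintype κ] [DecidableEq κ] [NormedAddCommGroup E] [NormedSpace ℝ E]

theorem contDiff_pderivAt {n : ℕ} {f : (κ → ℝ) → E} (hf : ContDiff ℝ (n + 1) f) (p : κ) :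
    ContDiff ℝ n (pderivAt p f) :=
  (hf.fderiv_right le_rfl).clm_apply contDiff_const

theorem hasDerivAt_pderivAt {f : (κ → ℝ) → E} {x : κ → ℝ} (hf : DifferentiableAt ℝ f x) (p : κ) :
    HasDerivAt (fun t : ℝ => f (x + t • (Pi.single p 1 : κ → ℝ))) (pderivAt p f x) 0 :=
  hf.hasFDerivAt.hasLineDerivAt _

theorem pderivAt_sub {f g : (κ → ℝ) → ℝ} {x : κ → ℝ} (hf : DifferentiableAt ℝ f x)
    (hg : DifferentiableAt ℝ g x) (p : κ) :
    pderivAt p (fun y => f y - g y) x = pderivAt p f x - pderivAt p g x := by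
  simp only [pderivAt]
  rw [fderiv_fun_sub hf hg]
  rfl

theorem pderivAt_mul {f g : (κ → ℝ) → ℝ} {x : κ → ℝ} (hf : DifferentiableAt ℝ f x)
    (hg : DifferentiableAt ℝ g x) (p : κ) :
    pderivAt p (fun y => f y * g y) x = pderivAt p f x * g x + f x * pderivAt p g x := by
  simp only [pderivAt]
  rw [fderiv_fun_mul hf hg]
  simp
  ring

theorem pderivAt_prod {ι : Type*} [DecidableEq ι] (s : Finset ι) {f : ι → (κ → ℝ) → ℝ} {x : κ → ℝ}
    (hf : ∀ i ∈ s, DifferentiableAt ℝ (f i) x) (p : κ) :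
    pderivAt p (fun y => ∏ i ∈ s, f i y) x =
      ∑ i ∈ s, pderivAt p (f i) x * ∏ j ∈ s.erase i, f j x := by
  simp only [pderivAt]
  rw [fderiv_finsetProd hf]
  simp [mul_comm]

theorem pderivAt_comm {f : (κ → ℝ) → E} (hf : ContDiff ℝ 2 f) (p q : κ) (x : κ → ℝ) :
    pderivAt p (pderivAt q f) x = pderivAt q (pderivAt p f) x := by
  have hd : DifferentiableAt ℝ (fderiv ℝ f) x :=
    ((hf.fderiv_right (m := 1) (by norm_num)).differentiable one_ne_zero) x
  have key : ∀ u v : κ → ℝ, fderiv ℝ (fun y => fderiv ℝ f y u) x v = fderiv ℝ (fderiv ℝ f) x v u := by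
    intro u v
    rw [fderiv_clm_apply hd (differentiableAt_const _)]
    simp
  have hs : IsSymmSndFDerivAt ℝ f x := hf.contDiffAt.isSymmSndFDerivAt (by simp)
  change fderiv ℝ (fun y => fderiv ℝ f y _) x _ = fderiv ℝ (fun y => fderiv ℝ f y _) x _
  rw [key, key, hs.eq]

theorem pderivAt_update {f : (κ → ℝ) → ℝ} (hf : Differentiable ℝ f) {p k : κ} (hk : k ≠ p) {c : ℝ}
    (hface : ∀ x, f (Function.update x p 1) = f (Function.update x p 0) + c) (x : κ → ℝ) :
    pderivAt k f (Function.update x p 1) = pderivAt k f (Function.update x p 0) := by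
  simp only [pderivAt]
  rw [← (hf _).lineDeriv_eq_fderiv, ← (hf _).lineDeriv_eq_fderiv]
  have key : ∀ (r t : ℝ), Function.update x p r + t • (Pi.single k 1 : κ → ℝ) =
      Function.update (x + t • (Pi.single k 1 : κ → ℝ)) p r := by
    intro r t
    ext j
    by_cases hj : j = p
    · subst hj
      simp [hk.symm]
    · simp [hj]
  simp only [lineDeriv, key, hface, deriv_add_const]

theorem integral_pderivAt_mul {f g : (κ → ℝ) → ℝ} (hf : ContDiff ℝ 1 f) (hg : ContDiff ℝ 1 g)
    {p : κ} (hff : ∀ x, f (Function.update x p 1) = f (Function.update x p 0))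
    (hgf : ∀ x, g (Function.update x p 1) = g (Function.update x p 0)) :
    ∫ x in Set.Icc (0 : κ → ℝ) 1, pderivAt p f x * g x =
      -∫ x in Set.Icc (0 : κ → ℝ) 1, f x * pderivAt p g x := by
  have h := integral_box_partial_eq_zero (fun x => f x * g x) (hf.mul hg) p
    (fun x => by rw [hff, hgf])
  have hc1 : Continuous (pderivAt p f) := (contDiff_pderivAt (n := 0) (by simpa using hf) p).continuous
  have hc2 : Continuous (pderivAt p g) := (contDiff_pderivAt (n := 0) (by simpa using hg) p).continuous
  have h2 : ∀ x, fderiv ℝ (fun x => f x * g x) x (Pi.single p 1) =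
      pderivAt p f x * g x + f x * pderivAt p g x := fun x =>
    pderivAt_mul (hf.differentiable one_ne_zero x) (hg.differentiable one_ne_zero x) p
  simp only [h2] at h
  rw [MeasureTheory.integral_add] at h
  · linarith
  · exact (hc1.mul hg.continuous).continuousOn.integrableOn_compact isCompact_Icc
  · exact (hf.continuous.mul hc2).continuousOn.integrableOn_compact isCompact_Icc

end Partial

section Alternating

variable {ι : Type*} [Fintype ι] [DecidableEq ι]

/-- The alternating sum over all ways of distributing the indices `ι × Fin 2` in pairs over the
bilinear forms `α a`; the coefficient of the volume form in the wedge product of the `α a`. -/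
def altSum (α : ι → ι × Fin 2 → ι × Fin 2 → ℝ) : ℝ :=
  ∑ π : Equiv.Perm (ι × Fin 2), ((Equiv.Perm.sign π : ℤ) : ℝ) * ∏ a, α a (π (a, 0)) (π (a, 1))

theorem sum_perm_eq_zero_of_swap {κ : Type*} [Fintype κ] [DecidableEq κ] {p q : κ} (hpq : p ≠ q)
    (F : Equiv.Perm κ → ℝ) (hF : ∀ π, F (π * Equiv.swap p q) = F π) :
    ∑ π : Equiv.Perm κ, ((Equiv.Perm.sign π : ℤ) : ℝ) * F π = 0 := by
  have h := Equiv.sum_comp (Equiv.mulRight (Equiv.swap p q))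
    (fun π : Equiv.Perm κ => ((Equiv.Perm.sign π : ℤ) : ℝ) * F π)
  simp only [Equiv.coe_mulRight, hF, Equiv.Perm.sign_mul, Equiv.Perm.sign_swap hpq] at h
  simp only [mul_neg, mul_one, Units.val_neg, Int.cast_neg, neg_mul, sum_neg_distrib] at h
  linarith

theorem altSum_eq_zero_of_symm {α : ι → ι × Fin 2 → ι × Fin 2 → ℝ} {a : ι}
    (h : ∀ p q, α a p q = α a q p) : altSum α = 0 := by
  refine sum_perm_eq_zero_of_swap (p := (a, 0)) (q := (a, 1)) (by simp) _ fun π => ?_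
  refine prod_congr rfl fun b _ => ?_
  by_cases hb : b = a
  · subst hb
    simp [h (π (b, 1))]
  · rw [Equiv.Perm.mul_apply, Equiv.Perm.mul_apply, Equiv.swap_apply_of_ne_of_ne,
      Equiv.swap_apply_of_ne_of_ne] <;> simp [hb]

theorem altSum_of_paired (c : ℝ) (W : ι → ι → ℝ) :
    altSum (fun a p q => if p.2 = 0 ∧ q = (p.1, 1) then c * W a p.1 else 0) =
      c ^ Fintype.card ι * ∑ τ : Equiv.Perm ι, ∏ a, W a (τ a) := by
  unfold altSum
  rw [mul_sum]
  let E : Equiv.Perm ι → Equiv.Perm (ι × Fin 2) := fun τ => τ.prodCongr (Equiv.refl _)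
  have hE : Function.Injective E := fun τ τ' h => by
    ext a
    have := congrArg (fun e : Equiv.Perm (ι × Fin 2) => (e (a, 0)).1) h
    simpa [E] using this
  rw [← sum_subset (subset_univ (univ.image E))]
  · rw [sum_image hE.injOn]
    refine sum_congr rfl fun τ _ => ?_
    have hs : Equiv.Perm.sign (E τ) = 1 := by
      have : E τ = Equiv.prodCongrLeft (fun _ : Fin 2 => τ) := by
        ext x <;> rfl
      rw [this, Equiv.Perm.sign_prodCongrLeft]
      simp
    rw [hs]
    simp [E, prod_mul_distrib]
  · intro π _ hπ
    by_contra hne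
    have h2 : ∏ a, (if (π (a, 0)).2 = 0 ∧ π (a, 1) = ((π (a, 0)).1, 1) then c * W a (π (a, 0)).1
        else 0) ≠ 0 := right_ne_zero_of_mul hne
    have h3 : ∀ a, (π (a, 0)).2 = 0 ∧ π (a, 1) = ((π (a, 0)).1, 1) := by
      intro a
      by_contra hc
      exact h2 (prod_eq_zero (mem_univ a) (if_neg hc))
    apply hπ
    have hinj : Function.Injective fun a => (π (a, 0)).1 := by
      intro a b hab
      have : π (a, 0) = π (b, 0) := Prod.ext hab ((h3 a).1.trans (h3 b).1.symm)
      simpa using π.injective this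
    refine mem_image.2 ⟨Equiv.ofBijective _ (Finite.injective_iff_bijective.1 hinj), mem_univ _, ?_⟩
    ext ⟨a, i⟩ : 1
    fin_cases i
    · exact Prod.ext rfl (h3 a).1.symm
    · exact (h3 a).2.symm

end Alternating

section Stokes

open MeasureTheory

variable {ι : Type*} [Fintype ι] [DecidableEq ι]

theorem integral_altSum_update_sub
    {B : ι → ι × Fin 2 → (ι × Fin 2 → ℝ) → ℝ} (hB : ∀ a l, ContDiff ℝ 2 (B a l))
    {c : ι → ι × Fin 2 → ι × Fin 2 → ℝ}
    (hBf : ∀ a p l, p ≠ l → ∀ x, B a l (Function.update x p 1) = B a l (Function.update x p 0) + c a p l)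
    {β : ι × Fin 2 → (ι × Fin 2 → ℝ) → ℝ} (hβ : ∀ l, ContDiff ℝ 2 (β l))
    (hβf : ∀ p l, p ≠ l → ∀ x, β l (Function.update x p 1) = β l (Function.update x p 0)) (a₀ : ι) :
    ∫ x in Set.Icc (0 : ι × Fin 2 → ℝ) 1, ∑ π : Equiv.Perm (ι × Fin 2),
      ((Equiv.Perm.sign π : ℤ) : ℝ) * (pderivAt (π (a₀, 0)) (β (π (a₀, 1))) x *
        ∏ a ∈ univ.erase a₀, pderivAt (π (a, 0)) (B a (π (a, 1))) x) = 0 := by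
  have hBd : ∀ a p l, ContDiff ℝ 1 (pderivAt p (B a l)) := fun a p l =>
    contDiff_pderivAt (n := 1) (by simpa [one_add_one_eq_two] using hB a l) p
  have hβd : ∀ p l, ContDiff ℝ 1 (pderivAt p (β l)) := fun p l =>
    contDiff_pderivAt (n := 1) (by simpa [one_add_one_eq_two] using hβ l) p
  have hβ1 : ∀ l, ContDiff ℝ 1 (β l) := fun l => (hβ l).of_le (by norm_num)
  let G : Equiv.Perm (ι × Fin 2) → (ι × Fin 2 → ℝ) → ℝ := fun π x =>
    ∏ a ∈ univ.erase a₀, pderivAt (π (a, 0)) (B a (π (a, 1))) x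
  have hG : ∀ π, ContDiff ℝ 1 (G π) := fun π => contDiff_prod fun a _ => hBd a _ _
  have hGc : ∀ π p, Continuous (pderivAt p (G π)) := fun π p =>
    (contDiff_pderivAt (n := 0) (by simpa using hG π) p).continuous
  have hint : ∀ f : (ι × Fin 2 → ℝ) → ℝ, Continuous f →
      Integrable f (volume.restrict (Set.Icc (0 : ι × Fin 2 → ℝ) 1)) := fun f hf =>
    hf.continuousOn.integrableOn_compact isCompact_Icc
  have key : ∀ π : Equiv.Perm (ι × Fin 2),
      ∫ x in Set.Icc (0 : ι × Fin 2 → ℝ) 1, pderivAt (π (a₀, 0)) (β (π (a₀, 1))) x * G π x =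
      -∫ x in Set.Icc (0 : ι × Fin 2 → ℝ) 1, β (π (a₀, 1)) x * pderivAt (π (a₀, 0)) (G π) x := by
    intro π
    apply integral_pderivAt_mul (hβ1 _) (hG π)
    · exact hβf _ _ (by simp)
    · intro x
      refine prod_congr rfl fun a ha => ?_
      have ha := (mem_erase.1 ha).1
      exact pderivAt_update ((hB _ _).differentiable two_ne_zero) (by simp [ha])
        (hBf _ _ _ (by simp)) x
  rw [integral_finsetSum]
  · simp only [integral_const_mul]
    change ∑ π : Equiv.Perm (ι × Fin 2), ((Equiv.Perm.sign π : ℤ) : ℝ) *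
      ∫ x in Set.Icc (0 : ι × Fin 2 → ℝ) 1, pderivAt (π (a₀, 0)) (β (π (a₀, 1))) x * G π x = 0
    simp only [key, mul_neg, sum_neg_distrib, neg_eq_zero]
    simp only [← integral_const_mul]
    rw [← integral_finsetSum]
    · rw [integral_eq_zero_of_ae]
      refine Filter.Eventually.of_forall fun x => ?_
      have hexp : ∀ π : Equiv.Perm (ι × Fin 2), pderivAt (π (a₀, 0)) (G π) x =
          ∑ a ∈ univ.erase a₀, pderivAt (π (a₀, 0)) (pderivAt (π (a, 0)) (B a (π (a, 1)))) x *
            ∏ b ∈ (univ.erase a₀).erase a, pderivAt (π (b, 0)) (B b (π (b, 1))) x := fun π =>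
        pderivAt_prod _ (fun a _ => (hBd a _ _).differentiable one_ne_zero x) _
      simp only [hexp, mul_sum, Pi.zero_apply]
      rw [sum_comm]
      refine sum_eq_zero fun a ha => ?_
      have ha := (mem_erase.1 ha).1
      refine sum_perm_eq_zero_of_swap (p := (a₀, 0)) (q := (a, 0)) (by simp [ha.symm]) _ fun π => ?_
      have h1 : ∀ b, (π * Equiv.swap (a₀, 0) (a, 0) : Equiv.Perm (ι × Fin 2)) (b, 1) = π (b, 1) := fun b => by
        rw [Equiv.Perm.mul_apply, Equiv.swap_apply_of_ne_of_ne] <;> simp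
      have h0 : ∀ b, b ≠ a₀ → b ≠ a → (π * Equiv.swap (a₀, 0) (a, 0) : Equiv.Perm (ι × Fin 2)) (b, 0) = π (b, 0) :=
        fun b h h' => by
          rw [Equiv.Perm.mul_apply, Equiv.swap_apply_of_ne_of_ne] <;> simp [h, h']
      have ha0 : (π * Equiv.swap (a₀, 0) (a, 0) : Equiv.Perm (ι × Fin 2)) (a₀, 0) = π (a, 0) := by simp
      have ha1 : (π * Equiv.swap (a₀, 0) (a, 0) : Equiv.Perm (ι × Fin 2)) (a, 0) = π (a₀, 0) := by simp
      rw [h1, h1, ha0, ha1, pderivAt_comm (hB _ _)]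
      congr 2
      refine prod_congr rfl fun b hb => ?_
      rw [h1, h0 b (by simp at hb; exact hb.2) (by simp at hb; exact hb.1)]
    · exact fun π _ => hint _ (continuous_const.mul ((hβ1 _).continuous.mul (hGc _ _)))
  · exact fun π _ => hint _ (continuous_const.mul ((hβd _ _).continuous.mul (hG π).continuous))

theorem continuous_altSum_pderivAt {B : ι → ι × Fin 2 → (ι × Fin 2 → ℝ) → ℝ}
    (hB : ∀ a l, ContDiff ℝ 2 (B a l)) :
    Continuous fun x => altSum fun a p q => pderivAt p (B a q) x := by
  have hBd : ∀ a p l, Continuous (pderivAt p (B a l)) := fun a p l =>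
    (contDiff_pderivAt (n := 1) (by simpa [one_add_one_eq_two] using hB a l) p).continuous
  exact continuous_finsetSum _ fun π _ => continuous_const.mul
    (continuous_finsetProd _ fun a _ => hBd _ _ _)

/-- Two families of one-forms on the cube whose coefficients jump by the same constants across
opposite faces have exterior derivatives with the same integrated wedge product. -/
theorem integral_altSum_congr {B C : ι → ι × Fin 2 → (ι × Fin 2 → ℝ) → ℝ}
    (hB : ∀ a l, ContDiff ℝ 2 (B a l)) (hC : ∀ a l, ContDiff ℝ 2 (C a l))
    {c : ι → ι × Fin 2 → ι × Fin 2 → ℝ}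
    (hBf : ∀ a p l, p ≠ l → ∀ x, B a l (Function.update x p 1) = B a l (Function.update x p 0) + c a p l)
    (hCf : ∀ a p l, p ≠ l → ∀ x, C a l (Function.update x p 1) = C a l (Function.update x p 0) + c a p l) :
    ∫ x in Set.Icc (0 : ι × Fin 2 → ℝ) 1, altSum (fun a p q => pderivAt p (B a q) x) =
      ∫ x in Set.Icc (0 : ι × Fin 2 → ℝ) 1, altSum (fun a p q => pderivAt p (C a q) x) := by
  suffices H : ∀ s : Finset ι,
      ∫ x in Set.Icc (0 : ι × Fin 2 → ℝ) 1, altSum (fun a p q => pderivAt p (B a q) x) =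
      ∫ x in Set.Icc (0 : ι × Fin 2 → ℝ) 1,
        altSum (fun a p q => pderivAt p ((if a ∈ s then C a else B a) q) x) by
    simpa using H univ
  intro s
  induction s using Finset.induction_on with
  | empty => simp
  | insert a₀ s ha₀ ih =>
    rw [ih, ← sub_eq_zero]
    have hF : ∀ (t : Finset ι) a l, ContDiff ℝ 2 ((if a ∈ t then C a else B a) l) := fun t a l => by
      split_ifs
      exacts [hC a l, hB a l]
    rw [← integral_sub]
    · refine Eq.trans (integral_congr_ae (Filter.Eventually.of_forall fun x => ?_))
        (integral_altSum_update_sub (B := fun a => if a ∈ s then C a else B a) (hF s) (c := c) ?_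
          (β := fun l x => B a₀ l x - C a₀ l x) (fun l => (hB _ _).sub (hC _ _)) ?_ a₀)
      · simp only [altSum]
        rw [← sum_sub_distrib]
        refine sum_congr rfl fun π _ => ?_
        rw [← mul_sub, ← mul_prod_erase _ _ (mem_univ a₀), ← mul_prod_erase _ _ (mem_univ a₀),
          pderivAt_sub ((hB _ _).differentiable two_ne_zero x)
            ((hC _ _).differentiable two_ne_zero x), if_neg ha₀, if_pos (mem_insert_self _ _), sub_mul]
        congr 3
        refine prod_congr rfl fun a ha => ?_
        simp [mem_insert, (mem_erase.1 ha).1]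
      · intro a p l h x
        by_cases has : a ∈ s
        · simpa [has] using hCf a p l h x
        · simpa [has] using hBf a p l h x
      · intro p l h x
        simp only [hCf a₀ p l h, hBf a₀ p l h]
        ring
    · exact (continuous_altSum_pderivAt (hF s)).continuousOn.integrableOn_compact isCompact_Icc
    · exact (continuous_altSum_pderivAt (hF _)).continuousOn.integrableOn_compact isCompact_Icc

end Stokes

section Connection

theorem exists_smooth_cutoff_inv {δ : ℝ} (hδ : 0 < δ) :
    ∃ ρ : ℝ → ℝ, ContDiff ℝ 2 ρ ∧ ∀ t, δ ≤ t → ρ t * t = 1 := by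
  let s : ℝ → ℝ := fun t => Real.smoothTransition (t / δ)
  have hs : ContDiff ℝ 2 s :=
    (Real.smoothTransition.contDiff (n := 2)).comp (contDiff_id.div_const δ)
  have hpos : ∀ t, t * s t + (1 - s t) ≠ 0 := by
    intro t
    rcases le_or_gt t 0 with ht | ht
    · have : s t = 0 := Real.smoothTransition.zero_of_nonpos (div_nonpos_of_nonpos_of_nonneg ht hδ.le)
      simp [this]
    · have h0 : 0 < s t := Real.smoothTransition.pos_of_pos (div_pos ht hδ)
      have h1 : s t ≤ 1 := Real.smoothTransition.le_one _
      have := mul_pos ht h0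
      linarith
  refine ⟨fun t => s t / (t * s t + (1 - s t)),
    hs.div ((contDiff_id.mul hs).add (contDiff_const.sub hs)) hpos, fun t ht => ?_⟩
  have : s t = 1 := Real.smoothTransition.one_of_one_le ((one_le_div hδ).2 ht)
  have ht0 : t ≠ 0 := (hδ.trans_le ht).ne'
  simp [this, ht0]

theorem contDiff_normSq_comp {κ : Type*} [Fintype κ] {σ : (κ → ℝ) → ℂ} {n : WithTop ℕ∞} (hσ : ContDiff ℝ n σ) :
    ContDiff ℝ n fun x => Complex.normSq (σ x) := by
  have hr : ContDiff ℝ n fun x => (σ x).re := Complex.reCLM.contDiff.comp hσ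
  have hi : ContDiff ℝ n fun x => (σ x).im := Complex.imCLM.contDiff.comp hσ
  simp only [Complex.normSq_apply]
  exact (hr.mul hr).add (hi.mul hi)

variable {κ : Type*} [Fintype κ] [DecidableEq κ]

/-- Away from the zeros of the section `σ` this is the logarithmic derivative of its phase; near the
zeros it is interpolated to the form `A`. -/
def connForm (ρ : ℝ → ℝ) (σ : (κ → ℝ) → ℂ) (A : κ → (κ → ℝ) → ℝ) (q : κ) (x : κ → ℝ) : ℝ :=
  A q x * (1 - ρ (Complex.normSq (σ x)) * Complex.normSq (σ x)) +
    ρ (Complex.normSq (σ x)) * (starRingEnd ℂ (σ x) * pderivAt q σ x).im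

theorem contDiff_connForm {ρ : ℝ → ℝ} {σ : (κ → ℝ) → ℂ} {A : κ → (κ → ℝ) → ℝ}
    (hρ : ContDiff ℝ 2 ρ) (hσ : ContDiff ℝ 3 σ) (hA : ∀ q, ContDiff ℝ 2 (A q)) (q : κ) :
    ContDiff ℝ 2 (connForm ρ σ A q) := by
  have hσ2 : ContDiff ℝ 2 σ := hσ.of_le (by norm_num)
  have hN := contDiff_normSq_comp hσ2
  have hd : ContDiff ℝ 2 (pderivAt q σ) := contDiff_pderivAt (n := 2) (by norm_num; exact hσ) q
  have hc : ContDiff ℝ 2 fun x => starRingEnd ℂ (σ x) := Complex.conjCLE.contDiff.comp hσ2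
  exact ((hA q).mul (contDiff_const.sub ((hρ.comp hN).mul hN))).add
    ((hρ.comp hN).mul (Complex.imCLM.contDiff.comp (hc.mul hd)))

theorem pderivAt_connForm_comm {ρ : ℝ → ℝ} {σ : (κ → ℝ) → ℂ} {A : κ → (κ → ℝ) → ℝ} {δ : ℝ}
    (hρ : ContDiff ℝ 2 ρ) (hσ : ContDiff ℝ 3 σ) (hA : ∀ q, ContDiff ℝ 2 (A q)) (hδ : 0 < δ)
    (hρδ : ∀ t, δ ≤ t → ρ t * t = 1) {x : κ → ℝ} (hx : δ < Complex.normSq (σ x)) (p q : κ) :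
    pderivAt p (connForm ρ σ A q) x = pderivAt q (connForm ρ σ A p) x := by
  have hσd : DifferentiableAt ℝ σ x := hσ.differentiable (by norm_num) x
  have hx0 : σ x ≠ 0 := by
    intro h
    rw [h] at hx
    simp at hx
    linarith
  have key : ∀ p q : κ, pderivAt p (connForm ρ σ A q) x =
      ((pderivAt p (pderivAt q σ) x * σ x - pderivAt q σ x * pderivAt p σ x) / σ x ^ 2).im := by
    intro p q
    have hdq : DifferentiableAt ℝ (pderivAt q σ) x :=
      (contDiff_pderivAt (n := 2) (by norm_num; exact hσ) q).differentiable (by norm_num) x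
    have h1 := hasDerivAt_pderivAt
      ((contDiff_connForm hρ hσ hA q).differentiable (by norm_num) x) p
    have h2 := (hasDerivAt_pderivAt hdq p).div (hasDerivAt_pderivAt hσd p) (by simpa using hx0)
    have h3 := Complex.imCLM.hasFDerivAt.comp_hasDerivAt (0 : ℝ) h2
    have hev : ∀ᶠ t in nhds (0 : ℝ), connForm ρ σ A q (x + t • (Pi.single p 1 : κ → ℝ)) =
        (pderivAt q σ (x + t • (Pi.single p 1 : κ → ℝ)) /
          σ (x + t • (Pi.single p 1 : κ → ℝ))).im := by
      have hc : Continuous fun t : ℝ =>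
          Complex.normSq (σ (x + t • (Pi.single p 1 : κ → ℝ))) :=
        (contDiff_normSq_comp hσ).continuous.comp (by fun_prop)
      have : ∀ᶠ t in nhds (0 : ℝ), δ < Complex.normSq (σ (x + t • (Pi.single p 1 : κ → ℝ))) :=
        hc.continuousAt.eventually (lt_mem_nhds (by simpa using hx))
      filter_upwards [this] with t ht
      set y := x + t • (Pi.single p 1 : κ → ℝ)
      have hN : Complex.normSq (σ y) ≠ 0 := (hδ.trans ht).ne'
      have hρy : ρ (Complex.normSq (σ y)) = (Complex.normSq (σ y))⁻¹ :=
        eq_inv_of_mul_eq_one_left (hρδ _ ht.le)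
      rw [connForm, hρδ _ ht.le, hρy, div_eq_mul_inv, Complex.inv_def]
      simp
      ring
    have h4 := h3.congr_of_eventuallyEq hev
    rw [h1.unique h4]
    simp
  rw [key, key, pderivAt_comm (hσ.of_le (by norm_num)), mul_comm (pderivAt p σ x)]

theorem connForm_update {ρ : ℝ → ℝ} {σ : (κ → ℝ) → ℂ} {A : κ → (κ → ℝ) → ℝ} {p l : κ} {c : ℝ}
    (hσ : Differentiable ℝ σ) (u : (κ → ℝ) → ℂ) (hu : ∀ x, ‖u x‖ = 1)
    (hud : ∀ x, HasDerivAt (fun t : ℝ => u (x + t • (Pi.single l 1 : κ → ℝ)))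
      (c * Complex.I * u x) 0)
    (hpl : l ≠ p) (hσf : ∀ x, σ (Function.update x p 1) = u x * σ (Function.update x p 0))
    (hAf : ∀ x, A l (Function.update x p 1) = A l (Function.update x p 0) + c) (x : κ → ℝ) :
    connForm ρ σ A l (Function.update x p 1) = connForm ρ σ A l (Function.update x p 0) + c := by
  have hcomm : ∀ (r t : ℝ), Function.update x p r + t • (Pi.single l 1 : κ → ℝ) =
      Function.update (x + t • (Pi.single l 1 : κ → ℝ)) p r := by
    intro r t
    ext j
    by_cases hj : j = p
    · subst hj
      simp [hpl.symm]
    · simp [hj]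
  have hd : pderivAt l σ (Function.update x p 1) =
      c * Complex.I * u x * σ (Function.update x p 0) + u x * pderivAt l σ (Function.update x p 0) := by
    have h1 := hasDerivAt_pderivAt (hσ (Function.update x p 1)) l
    have h0 := hasDerivAt_pderivAt (hσ (Function.update x p 0)) l
    simp only [hcomm] at h1 h0
    simp only [hσf] at h1
    rw [h1.unique ((hud x).mul h0)]
    simp
  have hu1 : starRingEnd ℂ (u x) * u x = 1 := by
    rw [mul_comm, Complex.mul_conj, Complex.normSq_eq_norm_sq, hu]
    simp
  have hN : Complex.normSq (σ (Function.update x p 1)) = Complex.normSq (σ (Function.update x p 0)) := by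
    rw [hσf, Complex.normSq_mul, Complex.normSq_eq_norm_sq (u x), hu]
    simp
  have him : (starRingEnd ℂ (σ (Function.update x p 1)) * pderivAt l σ (Function.update x p 1)).im =
      (starRingEnd ℂ (σ (Function.update x p 0)) * pderivAt l σ (Function.update x p 0)).im +
        c * Complex.normSq (σ (Function.update x p 0)) := by
    set s := σ (Function.update x p 0)
    have : starRingEnd ℂ (σ (Function.update x p 1)) * pderivAt l σ (Function.update x p 1) =
        starRingEnd ℂ s * pderivAt l σ (Function.update x p 0) +
          ((c * Complex.normSq s : ℝ) : ℂ) * Complex.I := by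
      rw [hd, hσf, map_mul, Complex.ofReal_mul, Complex.normSq_eq_conj_mul_self]
      linear_combination (starRingEnd ℂ s * pderivAt l σ (Function.update x p 0) +
        c * Complex.I * starRingEnd ℂ s * s) * hu1
    rw [this]
    simp
  rw [connForm, connForm, hN, him, hAf]
  ring

end Connection

section Torus

variable {ι : Type*} [Fintype ι] [DecidableEq ι]

open MeasureTheory in
/-- If quasi-periodic functions on the cube, with winding numbers `W`, have no common zero, then the
permanent of `W` vanishes. -/
theorem sum_perm_prod_eq_zero_of_no_common_zero (W : ι → ι → ℤ)
    (σ : ι → (ι × Fin 2 → ℝ) → ℂ) (hσ : ∀ a, ContDiff ℝ 3 (σ a))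
    (hσ1 : ∀ a b x, σ a (Function.update x (b, 1) 1) = σ a (Function.update x (b, 1) 0))
    (hσ0 : ∀ a b x, σ a (Function.update x (b, 0) 1) =
      Complex.exp ((2 * Real.pi * W a b * x (b, 1) : ℝ) * Complex.I) *
        σ a (Function.update x (b, 0) 0))
    (hne : ∀ x ∈ Set.Icc (0 : ι × Fin 2 → ℝ) 1, ∃ a, σ a x ≠ 0) :
    ∑ τ : Equiv.Perm ι, ∏ a, W a (τ a) = 0 := by
  obtain ⟨δ, hδ, hδne⟩ : ∃ δ : ℝ, 0 < δ ∧
      ∀ x ∈ Set.Icc (0 : ι × Fin 2 → ℝ) 1, ∃ a, δ < Complex.normSq (σ a x) := by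
    have hcN : ∀ a, Continuous fun x => Complex.normSq (σ a x) := fun a =>
      (contDiff_normSq_comp (hσ a)).continuous
    obtain ⟨x₀, hx₀, hmin⟩ := (isCompact_Icc (a := (0 : ι × Fin 2 → ℝ)) (b := 1)).exists_isMinOn
      ⟨0, le_rfl, zero_le_one⟩ (continuous_finsetSum univ fun a _ => hcN a).continuousOn
    obtain ⟨a₀, ha₀⟩ := hne x₀ hx₀
    have hm : 0 < ∑ a, Complex.normSq (σ a x₀) :=
      sum_pos' (fun _ _ => Complex.normSq_nonneg _) ⟨a₀, mem_univ _, Complex.normSq_pos.2 ha₀⟩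
    have hcard : (0 : ℝ) < Fintype.card ι := by exact_mod_cast Fintype.card_pos_iff.2 ⟨a₀⟩
    refine ⟨(∑ a, Complex.normSq (σ a x₀)) / (2 * Fintype.card ι), by positivity, fun x hx => ?_⟩
    by_contra! hcon
    have h1 := sum_le_card_nsmul univ _ _ fun a _ => hcon a
    have h2 : ∑ a, Complex.normSq (σ a x₀) ≤ ∑ a, Complex.normSq (σ a x) := hmin hx
    rw [card_univ, nsmul_eq_mul] at h1
    have h3 : (Fintype.card ι : ℝ) * ((∑ a, Complex.normSq (σ a x₀)) / (2 * Fintype.card ι)) =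
        (∑ a, Complex.normSq (σ a x₀)) / 2 := by
      field_simp
    linarith
  obtain ⟨ρ, hρ, hρδ⟩ := exists_smooth_cutoff_inv hδ
  let A : ι → ι × Fin 2 → (ι × Fin 2 → ℝ) → ℝ := fun a q x =>
    if q.2 = 1 then 2 * Real.pi * W a q.1 * x (q.1, 0) else 0
  let c : ι → ι × Fin 2 → ι × Fin 2 → ℝ := fun a p l =>
    if p.2 = 0 ∧ l = (p.1, 1) then 2 * Real.pi * W a p.1 else 0
  have hA : ∀ a q, ContDiff ℝ 2 (A a q) := by
    intro a q
    simp only [A]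
    split_ifs
    · fun_prop
    · exact contDiff_const
  have hAf : ∀ a p l, p ≠ l → ∀ x,
      A a l (Function.update x p 1) = A a l (Function.update x p 0) + c a p l := by
    rintro a ⟨b, i⟩ ⟨b', j⟩ h x
    by_cases hb : b' = b
    · subst hb
      fin_cases i <;> fin_cases j <;> simp [A, c] at h ⊢
    · simp [A, c, hb]
  have hγf : ∀ a p l, p ≠ l → ∀ x, connForm ρ (σ a) (A a) l (Function.update x p 1) =
      connForm ρ (σ a) (A a) l (Function.update x p 0) + c a p l := by
    rintro a ⟨b, i⟩ l h x
    fin_cases i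
    · refine connForm_update ((hσ a).differentiable (by norm_num))
        (fun x => Complex.exp ((2 * Real.pi * W a b * x (b, 1) : ℝ) * Complex.I))
        (fun x => Complex.norm_exp_ofReal_mul_I _) (fun x => ?_) h.symm (hσ0 a b) (hAf a _ l h) x
      have h1 : HasDerivAt (fun t : ℝ => (2 * Real.pi * W a b *
          (x + t • (Pi.single l 1 : ι × Fin 2 → ℝ)) (b, 1) : ℝ)) (c a (b, 0) l) 0 := by
        have h2 : HasDerivAt (fun t : ℝ => 2 * Real.pi * W a b * (x (b, 1) +
            t * (Pi.single l 1 : ι × Fin 2 → ℝ) (b, 1)))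
            (2 * Real.pi * W a b * (1 * (Pi.single l 1 : ι × Fin 2 → ℝ) (b, 1))) 0 :=
          (((hasDerivAt_id (0 : ℝ)).mul_const _).const_add _).const_mul _
        have h3 : c a (b, 0) l =
            2 * Real.pi * W a b * (1 * (Pi.single l 1 : ι × Fin 2 → ℝ) (b, 1)) := by
          by_cases hl : l = (b, 1)
          · simp [c, hl]
          · simp [c, hl, Ne.symm hl]
        rw [h3]
        exact h2
      have h3 := ((h1.ofReal_comp).mul_const Complex.I).cexp
      convert h3 using 1
      simp
      ring
    · have hc : c a (b, 1) l = 0 := by simp [c]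
      refine connForm_update ((hσ a).differentiable (by norm_num)) (fun _ => 1) (by simp)
        (fun x => ?_) h.symm (by simpa using hσ1 a b) (hAf a _ l h) x
      simpa [hc] using hasDerivAt_const (0 : ℝ) (1 : ℂ)
  have hint := integral_altSum_congr
    (fun a q => contDiff_connForm hρ (hσ a) (hA a) q) hA hγf hAf
  have hleft : ∫ x in Set.Icc (0 : ι × Fin 2 → ℝ) 1,
      altSum (fun a p q => pderivAt p (connForm ρ (σ a) (A a) q) x) = 0 := by
    rw [setIntegral_congr_fun (g := fun _ => (0 : ℝ)) measurableSet_Icc]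
    · simp
    · intro x hx
      obtain ⟨a, ha⟩ := hδne x hx
      exact altSum_eq_zero_of_symm (a := a) fun p q =>
        pderivAt_connForm_comm hρ (hσ a) (hA a) hδ hρδ ha p q
  have hpd : ∀ x a p q, pderivAt p (A a q) x =
      if p.2 = 0 ∧ q = (p.1, 1) then 2 * Real.pi * (W a p.1 : ℝ) else 0 := by
    intro x a p q
    refine (hasDerivAt_pderivAt ((hA a q).differentiable two_ne_zero x) p).unique ?_
    have h2 : HasDerivAt (fun t : ℝ => if q.2 = 1 then 2 * Real.pi * W a q.1 * (x (q.1, 0) +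
        t * (Pi.single p 1 : ι × Fin 2 → ℝ) (q.1, 0)) else 0)
        (if q.2 = 1 then 2 * Real.pi * W a q.1 *
          (1 * (Pi.single p 1 : ι × Fin 2 → ℝ) (q.1, 0)) else 0) 0 := by
      split_ifs
      · exact (((hasDerivAt_id (0 : ℝ)).mul_const _).const_add _).const_mul _
      · exact hasDerivAt_const _ _
    have h3 : (if p.2 = 0 ∧ q = (p.1, 1) then 2 * Real.pi * (W a p.1 : ℝ) else 0) =
        if q.2 = 1 then 2 * Real.pi * W a q.1 *
          (1 * (Pi.single p 1 : ι × Fin 2 → ℝ) (q.1, 0)) else 0 := by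
      obtain ⟨b, i⟩ := p
      obtain ⟨b', j⟩ := q
      by_cases hb : b' = b
      · subst hb
        fin_cases i <;> fin_cases j <;> simp
      · simp [hb]
    rw [h3]
    exact h2
  have hright : ∀ x : ι × Fin 2 → ℝ, altSum (fun a p q => pderivAt p (A a q) x) =
      (2 * Real.pi) ^ Fintype.card ι * ∑ τ : Equiv.Perm ι, ∏ a, (W a (τ a) : ℝ) := by
    intro x
    simp only [hpd]
    exact altSum_of_paired (2 * Real.pi) fun a b => (W a b : ℝ)
  rw [hleft] at hint
  simp only [hright] at hint
  rw [setIntegral_const, measureReal_def, Real.volume_Icc_pi_toReal zero_le_one] at hint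
  simp [Real.pi_ne_zero] at hint
  exact_mod_cast hint

end Torus

section CommonZero

open MvPolynomial in
theorem coeff_prod_linear {I A : Type*} [Fintype I] [DecidableEq I] [Fintype A] [DecidableEq A]
    (d : ℕ) (w : A → I → ℤ) :
    coeff (Finsupp.equivFunOnFinite.symm fun _ : I => d) (∏ a, ∑ i, C (w a i) * X i) =
      ∑ g : A → I with ∀ i, #{a | g a = i} = d, ∏ a, w a (g a) := by
  rw [Finset.prod_univ_sum, coeff_sum, Fintype.piFinset_univ, sum_filter]
  refine sum_congr rfl fun g _ => ?_
  have h1 : (∏ a, (C (w a (g a)) * X (g a) : MvPolynomial I ℤ)) =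
      monomial (∑ a, Finsupp.single (g a) 1) (∏ a, w a (g a)) := by
    simp only [X]
    rw [prod_mul_distrib, ← map_prod, ← monomial_sum_one, C_mul_monomial, mul_one]
  rw [h1, coeff_monomial]
  refine if_congr ?_ rfl rfl
  rw [Finsupp.ext_iff]
  refine forall_congr' fun i => ?_
  rw [card_filter, Finsupp.finsetSum_apply]
  simp only [Finsupp.single_apply]
  rfl

theorem exists_equiv_of_card_fiber {I A : Type*} [DecidableEq I] [Fintype A]
    {d : ℕ} {g : A → I} (hg : ∀ i, #{a | g a = i} = d) :
    ∃ E : A ≃ I × Fin d, ∀ a, (E a).1 = g a := by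
  have hc : ∀ i, Fintype.card {a // g a = i} = d := fun i => by
    rw [Fintype.card_subtype, hg]
  refine ⟨(Equiv.sigmaFiberEquiv g).symm.trans ((Equiv.sigmaCongrRight fun i =>
    Fintype.equivFinOfCardEq (hc i)).trans (Equiv.sigmaEquivProd I (Fin d))), fun a => rfl⟩

theorem sum_equiv_prod_fst_ne_zero {I A : Type*} [Fintype I] [DecidableEq I] [Fintype A]
    [DecidableEq A] (d : ℕ) (w : A → I → ℤ)
    (hw : ∑ g : A → I with ∀ i, #{a | g a = i} = d, ∏ a, w a (g a) ≠ 0) :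
    ∑ E : A ≃ I × Fin d, ∏ a, w a (E a).1 ≠ 0 := by
  have hmaps : ∀ E ∈ (univ : Finset (A ≃ I × Fin d)), (fun a => (E a).1) ∈
      ({g : A → I | ∀ i, #{a | g a = i} = d} : Finset (A → I)) := by
    intro E _
    simp only [mem_filter, mem_univ, true_and]
    intro i
    have : ({a | (E a).1 = i} : Finset A) = (({i} : Finset I) ×ˢ (univ : Finset (Fin d))).map
        E.symm.toEmbedding := by
      ext a
      simp only [mem_filter, mem_univ, true_and, mem_map_equiv, Equiv.symm_symm, mem_product,
        mem_singleton, and_true]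
    rw [this]
    simp
  rw [← sum_fiberwise_of_maps_to hmaps]
  have hfib : ∀ g ∈ ({g : A → I | ∀ i, #{a | g a = i} = d} : Finset (A → I)),
      ∑ E : A ≃ I × Fin d with (fun a => (E a).1) = g, ∏ a, w a (E a).1 =
      (#{π : Equiv.Perm (I × Fin d) | (fun p => (π p).1) = Prod.fst} : ℤ) * ∏ a, w a (g a) := by
    intro g hg
    obtain ⟨E₀, hE₀⟩ := exists_equiv_of_card_fiber (by simpa using hg : ∀ i, #{a | g a = i} = d)
    have h1 : ∀ E ∈ ({E : A ≃ I × Fin d | (fun a => (E a).1) = g} : Finset (A ≃ I × Fin d)),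
        ∏ a, w a (E a).1 = ∏ a, w a (g a) := by
      intro E hE
      rw [← (mem_filter.1 hE).2]
    rw [sum_congr rfl h1, sum_const, nsmul_eq_mul]
    congr 2
    refine card_bij (fun E _ => E₀.symm.trans E) ?_ ?_ ?_
    · intro E hE
      have hE := (mem_filter.1 hE).2
      refine mem_filter.2 ⟨mem_univ _, funext fun p => ?_⟩
      have := congrFun hE (E₀.symm p)
      rw [← hE₀, E₀.apply_symm_apply] at this
      exact this
    · intro E _ E' _ h
      ext a : 1
      simpa using congrArg (fun e : Equiv.Perm (I × Fin d) => e (E₀ a)) h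
    · intro π hπ
      have hπ := (mem_filter.1 hπ).2
      refine ⟨E₀.trans π, mem_filter.2 ⟨mem_univ _, funext fun a => ?_⟩, ?_⟩
      · rw [Equiv.trans_apply, ← hE₀]
        exact congrFun hπ _
      · ext p : 1
        simp
  rw [sum_congr rfl hfib, ← mul_sum]
  refine mul_ne_zero ?_ hw
  exact_mod_cast (card_pos.2 ⟨1, by simp⟩).ne'

/-- A quasi-periodic parametrization of linear forms in one variable by the unit square. -/
def squareFactor (j : ℕ) (s y : ℝ) : ℂ :=
  1 - s + s * Complex.exp (2 * Real.pi * y * Complex.I) + j * (s * (1 - s))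

theorem squareFactor_eq_zero_unique {s y : ℝ} {j k : ℕ} (hj : squareFactor j s y = 0)
    (hk : squareFactor k s y = 0) : j = k := by
  have h : ((j : ℂ) - k) * (s * (1 - s)) = 0 := by
    unfold squareFactor at hj hk
    linear_combination hj - hk
  rcases mul_eq_zero.1 h with h | h
  · exact_mod_cast sub_eq_zero.1 h
  · exfalso
    rcases mul_eq_zero.1 h with h | h
    · simp [squareFactor, h] at hj
    · have : (s : ℂ) = 1 := (sub_eq_zero.1 h).symm
      simp [squareFactor, this] at hj

/-- The coefficients, in a Lagrange-type basis, of a product of `d` linear forms for each `i`. -/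
def squareMap {I : Type*} (d : ℕ) (x : (I × Fin d) × Fin 2 → ℝ) (i : I) (j : Fin (d + 1)) : ℂ :=
  ∏ b, squareFactor j (x ((i, b), 0)) (x ((i, b), 1))

theorem squareMap_ne_zero {I : Type*} {d : ℕ} (x : (I × Fin d) × Fin 2 → ℝ) (i : I) :
    squareMap d x i ≠ 0 := by
  intro h
  have h1 : ∀ j : Fin (d + 1), ∃ b, squareFactor j (x ((i, b), 0)) (x ((i, b), 1)) = 0 := fun j => by
    simpa [squareMap, prod_eq_zero_iff] using congrFun h j
  choose b hb using h1
  have hinj : Function.Injective b := fun j k hjk =>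
    Fin.ext (squareFactor_eq_zero_unique (hb j) (by rw [hjk]; exact hb k))
  simpa using Fintype.card_le_of_injective b hinj

theorem contDiff_squareMap {I : Type*} [Fintype I] {d : ℕ} {n : WithTop ℕ∞} :
    ContDiff ℝ n (squareMap (I := I) d) := by
  refine contDiff_pi.2 fun i => contDiff_pi.2 fun j => contDiff_prod fun b _ => ?_
  have h0 : ∀ k, ContDiff ℝ n fun x : (I × Fin d) × Fin 2 → ℝ => (x k : ℂ) := fun k =>
    Complex.ofRealCLM.contDiff.comp (contDiff_apply ℝ ℝ k)
  unfold squareFactor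
  exact ((contDiff_const.sub (h0 _)).add ((h0 _).mul
    ((contDiff_const.mul (h0 _)).mul contDiff_const).cexp)).add
    (contDiff_const.mul ((h0 _).mul (contDiff_const.sub (h0 _))))

variable {I : Type*} [DecidableEq I] {d : ℕ}

theorem squareMap_update_zero (x : (I × Fin d) × Fin 2 → ℝ) (i : I) (b : Fin d) :
    squareMap d (Function.update x ((i, b), 0) 1) =
      Function.update (squareMap d (Function.update x ((i, b), 0) 0)) i
        (Complex.exp (2 * Real.pi * x ((i, b), 1) * Complex.I) •
          squareMap d (Function.update x ((i, b), 0) 0) i) := by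
  ext i' j
  by_cases hi : i' = i
  · subst hi
    simp only [squareMap, Function.update_self, Pi.smul_apply, smul_eq_mul]
    rw [← mul_prod_erase _ _ (mem_univ b), ← mul_prod_erase _ _ (mem_univ b), ← mul_assoc]
    congr 1
    · simp [squareFactor]
    · refine prod_congr rfl fun b' hb' => ?_
      simp [(mem_erase.1 hb').1]
  · simp [squareMap, hi]

theorem squareMap_update_one (x : (I × Fin d) × Fin 2 → ℝ) (i : I) (b : Fin d) :
    squareMap d (Function.update x ((i, b), 1) 1) =
      squareMap d (Function.update x ((i, b), 1) 0) := by
  ext i' j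
  refine prod_congr rfl fun b' _ => ?_
  by_cases h : (i', b') = (i, b)
  · rw [h]
    simp [squareFactor, Complex.exp_two_pi_mul_I]
  · simp [h]

/-- Sections of weights `w a` on a product of projective spaces have a common zero when the product
of their weights has a nonzero top coefficient. -/
theorem exists_common_zero [Fintype I] {A : Type*} [Fintype A]
    (S : A → (I → Fin (d + 1) → ℂ) → ℂ) (hS : ∀ a, ContDiff ℝ 3 (S a)) (w : A → I → ℤ)
    (hSw : ∀ a i f (z : ℂ), ‖z‖ = 1 → S a (Function.update f i (z • f i)) = z ^ w a i * S a f)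
    (hw : MvPolynomial.coeff (Finsupp.equivFunOnFinite.symm fun _ : I => d)
      (∏ a, ∑ i, MvPolynomial.C (w a i) * MvPolynomial.X i) ≠ 0) :
    ∃ f : I → Fin (d + 1) → ℂ, (∀ i, f i ≠ 0) ∧ ∀ a, S a f = 0 := by
  classical
  rw [coeff_prod_linear] at hw
  by_contra! hcon
  obtain ⟨g, hg, -⟩ := exists_ne_zero_of_sum_ne_zero hw
  obtain ⟨E, -⟩ := exists_equiv_of_card_fiber (by simpa using hg : ∀ i, #{a | g a = i} = d)
  apply sum_equiv_prod_fst_ne_zero d w hw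
  have h := sum_perm_prod_eq_zero_of_no_common_zero (ι := I × Fin d)
    (fun a b => w (E.symm a) b.1) (fun a x => S (E.symm a) (squareMap d x))
    (fun a => (hS _).comp contDiff_squareMap)
    (fun a b x => by rw [squareMap_update_one])
    (fun a b x => by
      rw [squareMap_update_zero, hSw, ← Complex.exp_int_mul]
      · congr 2
        push_cast
        ring
      · have := Complex.norm_exp_ofReal_mul_I (2 * Real.pi * x ((b.1, b.2), 1))
        push_cast at this
        exact this)
    (fun x _ => by
      obtain ⟨a, ha⟩ := hcon (squareMap d x) (squareMap_ne_zero x)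
      exact ⟨E a, by simpa using ha⟩)
  rw [← h]
  refine sum_equiv (Equiv.equivCongr E (Equiv.refl _)) (by simp) fun F _ => ?_
  rw [← E.symm.prod_comp]
  rfl

end CommonZero

section Division

variable {R : Type*} [CommRing R]

/-- The signed complete homogeneous symmetric polynomials in two variables. -/
def signedSymm (x y : R) : ℕ → R
  | 0 => 1
  | 1 => -(x + y)
  | n + 2 => -(x + y) * signedSymm x y (n + 1) - x * y * signedSymm x y n

/-- The polynomial quotient of `t ^ (n + 2)` by `(t + x) * (t + y)`. -/
def quadQuot (t x y : R) : ℕ → R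
  | 0 => 1
  | n + 1 => t * quadQuot t x y n + signedSymm x y (n + 1)

theorem map_signedSymm {S : Type*} [CommRing S] (f : R →+* S) (x y : R) :
    ∀ n, f (signedSymm x y n) = signedSymm (f x) (f y) n
  | 0 => by simp [signedSymm]
  | 1 => by simp [signedSymm]
  | n + 2 => by simp [signedSymm, map_signedSymm f x y n, map_signedSymm f x y (n + 1)]

theorem map_quadQuot {S : Type*} [CommRing S] (f : R →+* S) (t x y : R) (n : ℕ) :
    f (quadQuot t x y n) = quadQuot (f t) (f x) (f y) n := by
  induction n with
  | zero => simp [quadQuot]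
  | succ n ih => simp [quadQuot, ih, map_signedSymm]

theorem quad_mul_quadQuot (t x y : R) (n : ℕ) :
    (t + x) * (t + y) * quadQuot t x y n =
      t ^ (n + 2) - signedSymm x y (n + 1) * t + x * y * signedSymm x y n := by
  induction n with
  | zero => simp [quadQuot, signedSymm]; ring
  | succ n ih =>
    simp only [quadQuot, signedSymm]
    linear_combination t * ih

theorem sub_mul_signedSymm (x y : R) :
    ∀ n, (x - y) * signedSymm x y n = (-1) ^ n * (x ^ (n + 1) - y ^ (n + 1))
  | 0 => by simp [signedSymm]
  | 1 => by simp [signedSymm]; ring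
  | n + 2 => by
    have h0 := sub_mul_signedSymm x y n
    have h1 := sub_mul_signedSymm x y (n + 1)
    simp only [signedSymm]
    linear_combination -(x + y) * h1 - x * y * h0

theorem quadQuot_add_two (x y : R) (n : ℕ) :
    (x - y) * quadQuot (x + y) x y (n + 2) = (x + y) ^ 2 * ((x - y) * quadQuot (x + y) x y n) -
      (-1) ^ n * (x * y * (x ^ (n + 1) - y ^ (n + 1))) := by
  have h := sub_mul_signedSymm x y n
  simp only [quadQuot, signedSymm]
  linear_combination -(x * y) * h

/-- A combination of odd power differences, homogeneous of degree `2 * m - 1`. -/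
def oddDiffSum (m : ℕ) (c : ℕ → ℤ) (x y : R) : R :=
  ∑ j ∈ range m, c j * ((x * y) ^ j * (x ^ (2 * (m - 1 - j) + 1) - y ^ (2 * (m - 1 - j) + 1)))

theorem oddDiffSum_succ (m : ℕ) (c : ℕ → ℤ) (x y : R) :
    oddDiffSum (m + 1) c x y = c 0 * (x ^ (2 * m + 1) - y ^ (2 * m + 1)) +
      x * y * oddDiffSum m (fun j => c (j + 1)) x y := by
  rw [oddDiffSum, sum_range_succ', oddDiffSum, mul_sum, add_comm]
  congr 1
  · simp
  · refine sum_congr rfl fun j _ => ?_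
    rw [show m + 1 - 1 - (j + 1) = m - 1 - j by omega]
    ring

theorem exists_sq_mul_oddDiffSum (m : ℕ) (c : ℕ → ℤ) (hc : ∀ j < m + 1, 1 ≤ c j) :
    ∃ c' : ℕ → ℤ, (∀ j < m + 2, 1 ≤ c' j) ∧ (1 ≤ m → 2 ≤ c' 1) ∧
      ∀ (R : Type) [CommRing R] (x y : R),
        (x + y) ^ 2 * oddDiffSum (m + 1) c x y = oddDiffSum (m + 2) c' x y := by
  induction m generalizing c with
  | zero =>
    refine ⟨fun _ => c 0, fun _ _ => hc 0 (by simp), by simp, fun R _ x y => ?_⟩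
    simp only [oddDiffSum_succ]
    simp [oddDiffSum]
    ring
  | succ m ih =>
    obtain ⟨c', h1, -, h2⟩ := ih (fun j => c (j + 1)) fun j hj => hc _ (by omega)
    have hc0 := hc 0 (by simp)
    refine ⟨fun j => match j with
      | 0 => c 0
      | 1 => c' 0 + 2 * c 0
      | 2 => c' 1 + c 0
      | j + 3 => c' (j + 2), ?_, ?_, fun R _ x y => ?_⟩
    · rintro (_ | _ | _ | j) hj
      · exact hc0
      · have := h1 0 (by omega)
        simp only
        omega
      · have := h1 1 (by omega)
        simp only
        omega
      · exact h1 (j + 2) (by omega)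
    · intro _
      have := h1 0 (by omega)
      simp only
      omega
    · rw [oddDiffSum_succ, mul_add, show (x + y) ^ 2 * (x * y * oddDiffSum (m + 1)
        (fun j => c (j + 1)) x y) = x * y * ((x + y) ^ 2 * oddDiffSum (m + 1)
        (fun j => c (j + 1)) x y) by ring, h2]
      simp only [oddDiffSum_succ]
      push_cast
      ring

theorem exists_oddDiffSum_even (m : ℕ) :
    ∃ c : ℕ → ℤ, (∀ j < m + 3, 1 ≤ c j) ∧ ∀ (R : Type) [CommRing R] (x y : R),
      (x - y) * quadQuot (x + y) x y (2 * m + 4) = oddDiffSum (m + 3) c x y := by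
  induction m with
  | zero =>
    refine ⟨fun _ => 1, by simp, fun R _ x y => ?_⟩
    simp [oddDiffSum, quadQuot, signedSymm, sum_range_succ]
    ring
  | succ m ih =>
    obtain ⟨c, hc, h⟩ := ih
    obtain ⟨c', h1, h2, h3⟩ := exists_sq_mul_oddDiffSum (m + 2) c hc
    refine ⟨fun j => if j = 1 then c' 1 - 1 else c' j, fun j hj => ?_, fun R _ x y => ?_⟩
    · have := h2 (by omega)
      have := h1 j (by omega)
      dsimp only
      split_ifs <;> omega
    · rw [show 2 * (m + 1) + 4 = 2 * m + 4 + 2 by ring, quadQuot_add_two, h, h3,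
        Even.neg_one_pow ⟨m + 2, by ring⟩]
      simp only [oddDiffSum_succ]
      simp
      ring

theorem exists_oddDiffSum_odd (m : ℕ) :
    ∃ c : ℕ → ℤ, (∀ j < m + 2, 1 ≤ c j) ∧ ∀ (R : Type) [CommRing R] (x y : R),
      (x - y) * quadQuot (x + y) x y (2 * m + 3) * (x + y) =
        x * y * oddDiffSum (m + 2) c x y := by
  induction m with
  | zero =>
    refine ⟨fun _ => 1, by simp, fun R _ x y => ?_⟩
    simp [oddDiffSum, quadQuot, signedSymm, sum_range_succ]
    ring
  | succ m ih =>
    obtain ⟨c, hc, h⟩ := ih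
    obtain ⟨c', h1, h2, h3⟩ := exists_sq_mul_oddDiffSum (m + 1) c hc
    refine ⟨fun j => if j = 0 ∨ j = 1 then c' j + 1 else c' j, fun j hj => ?_, fun R _ x y => ?_⟩
    · have := h1 j (by omega)
      dsimp only
      split_ifs <;> omega
    · rw [show 2 * (m + 1) + 3 = 2 * m + 3 + 2 by ring, quadQuot_add_two,
        Odd.neg_one_pow ⟨m + 1, by ring⟩]
      have h4 : ((x + y) ^ 2 * ((x - y) * quadQuot (x + y) x y (2 * m + 3))) * (x + y) =
          x * y * oddDiffSum (m + 3) c' x y := by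
        rw [← h3]
        linear_combination (x + y) ^ 2 * h R x y
      simp only [oddDiffSum_succ] at h4 ⊢
      simp at h4 ⊢
      linear_combination h4

/-- In an algebra where the `M`-th powers of the `M` points `x i` vanish, the Vandermonde
determinant absorbs `∏ i, (t + x i)`. -/
theorem det_vandermonde_mul_prod_add {M : ℕ} (x : Fin M → R) (hx : ∀ i, x i ^ M = 0) (t : R) :
    (Matrix.vandermonde x).det * ∏ i, (t + x i) = t ^ M * (Matrix.vandermonde x).det := by
  have h1 : (Matrix.vandermonde (Fin.cons (-t) x : Fin (M + 1) → R)).det =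
      (∏ i, (t + x i)) * (Matrix.vandermonde x).det := by
    rw [Matrix.det_vandermonde, Fin.prod_univ_succ, Matrix.det_vandermonde]
    congr 1
    · simp [add_comm]
    · simp [Fin.prod_Ioi_succ]
  rw [mul_comm, ← h1, Matrix.det_succ_column _ (Fin.last M), Fin.sum_univ_succ, sum_eq_zero]
  · have h2 : (Matrix.vandermonde (Fin.cons (-t) x : Fin (M + 1) → R)).submatrix (Fin.succAbove 0)
        (Fin.last M).succAbove = Matrix.vandermonde x := by
      ext i j
      rw [Matrix.submatrix_apply, Matrix.vandermonde_apply, Matrix.vandermonde_apply]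
      simp
    rw [h2]
    simp [Matrix.vandermonde_apply]
    rw [← mul_pow, neg_mul_neg, one_mul]
  · intro i _
    simp [Matrix.vandermonde_apply, hx]

open Polynomial in
theorem det_vandermonde_mul_prod_erase_pair {M : ℕ} (x : Fin (M + 2) → R)
    (hx : ∀ i, x i ^ (M + 2) = 0) {a b : Fin (M + 2)} (hab : a ≠ b) (t : R) :
    (Matrix.vandermonde x).det * ∏ i ∈ (univ.erase a).erase b, (t + x i) =
      (Matrix.vandermonde x).det * quadQuot t (x a) (x b) M := by
  nontriviality R
  let D : R := (Matrix.vandermonde x).det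
  have hD : (Matrix.vandermonde fun i => (C (x i) : R[X])).det = C D := by
    rw [Matrix.det_vandermonde, show D = _ from Matrix.det_vandermonde x]
    simp
  have h1 := det_vandermonde_mul_prod_add (fun i => (C (x i) : R[X]))
    (fun i => by rw [← C_pow, hx, C_0]) X
  rw [hD, ← mul_prod_erase _ _ (mem_univ a),
    ← mul_prod_erase _ _ (mem_erase.2 ⟨hab.symm, mem_univ b⟩)] at h1
  have h2 := quad_mul_quadQuot (X : R[X]) (C (x a)) (C (x b)) M
  set f : R[X] := C D * ∏ i ∈ (univ.erase a).erase b, (X + C (x i)) -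
    C D * quadQuot X (C (x a)) (C (x b)) M with hf
  have hp : ((X + C (x a)) * (X + C (x b))).Monic := (monic_X_add_C _).mul (monic_X_add_C _)
  have h3 : f * ((X + C (x a)) * (X + C (x b))) =
      C (D * signedSymm (x a) (x b) (M + 1)) * X + C (-(D * x a * x b * signedSymm (x a) (x b) M)) := by
    have e : ∀ n, (C (signedSymm (x a) (x b) n) : R[X]) = signedSymm (C (x a)) (C (x b)) n :=
      map_signedSymm C _ _
    simp only [map_mul, map_neg, e]
    linear_combination h1 - C D * h2
  have hf0 : f = 0 := by
    by_contra hne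
    have h4 := hp.degree_mul (p := f)
    rw [h3, (monic_X_add_C (x b)).degree_mul, degree_X_add_C, degree_X_add_C,
      degree_eq_natDegree hne] at h4
    have h5 := degree_linear_le (a := D * signedSymm (x a) (x b) (M + 1))
      (b := -(D * x a * x b * signedSymm (x a) (x b) M))
    rw [h4] at h5
    have h6 : f.natDegree + (1 + 1) ≤ 1 := by exact_mod_cast h5
    omega
  have h7 := congrArg (eval t) hf0
  rw [hf] at h7
  have h8 : eval t (quadQuot X (C (x a)) (C (x b)) M) = quadQuot t (x a) (x b) M := by
    simpa using map_quadQuot (evalRingHom t) X (C (x a)) (C (x b)) M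
  simp [h8, eval_prod] at h7
  exact sub_eq_zero.1 h7

end Division

section Coefficient

theorem exists_pair_factor {n : ℕ} (hn : 3 ≤ n) :
    ∃ c : ℕ → ℤ, (∀ j < (n + 2) / 2, 1 ≤ c j) ∧ ∀ (R : Type) [CommRing R] (x y : R),
      (x - y) * quadQuot (x + y) x y n * (x + y) ^ (n % 2) =
        (x * y) ^ (n % 2) * oddDiffSum ((n + 2) / 2) c x y := by
  rcases Nat.even_or_odd' n with ⟨k, rfl | rfl⟩
  · obtain ⟨l, rfl⟩ : ∃ l, k = l + 2 := ⟨k - 2, by omega⟩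
    obtain ⟨c, h1, h2⟩ := exists_oddDiffSum_even l
    refine ⟨c, fun j hj => h1 j (by omega), fun R _ x y => ?_⟩
    rw [show 2 * (l + 2) % 2 = 0 by omega, show (2 * (l + 2) + 2) / 2 = l + 3 by omega,
      show 2 * (l + 2) = 2 * l + 4 by ring, h2]
    simp
  · obtain ⟨l, rfl⟩ : ∃ l, k = l + 1 := ⟨k - 1, by omega⟩
    obtain ⟨c, h1, h2⟩ := exists_oddDiffSum_odd l
    refine ⟨c, fun j hj => h1 j (by omega), fun R _ x y => ?_⟩
    rw [show (2 * (l + 1) + 1) % 2 = 1 by omega, show (2 * (l + 1) + 1 + 2) / 2 = l + 2 by omega,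
      show 2 * (l + 1) + 1 = 2 * l + 3 by ring, pow_one, pow_one, h2]

/-- The first member of the `k`-th pair. -/
def pairFst {M : ℕ} (k : Fin (M / 2)) : Fin M := ⟨2 * k, by omega⟩

/-- The second member of the `k`-th pair. -/
def pairSnd {M : ℕ} (k : Fin (M / 2)) : Fin M := ⟨2 * k + 1, by omega⟩

theorem pairFst_ne_pairSnd {M : ℕ} (k : Fin (M / 2)) : pairFst k ≠ pairSnd k := by
  simp [pairFst, pairSnd]

/-- The indices outside the `k`-th pair. -/
def pairCompl {M : ℕ} (k : Fin (M / 2)) : Finset (Fin M) :=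
  (univ.erase (pairFst k)).erase (pairSnd k)

theorem prod_eq_prod_pairs {M : ℕ} {R : Type*} [CommMonoid R] (g : Fin M → R)
    (hg : ∀ i : Fin M, M / 2 ≤ i.val / 2 → g i = 1) :
    ∏ i, g i = ∏ k : Fin (M / 2), g (pairFst k) * g (pairSnd k) := by
  have h : ∀ k : Fin (M / 2), g (pairFst k) * g (pairSnd k) =
      ∏ r : Fin 2, g ⟨2 * k + r, by omega⟩ := fun k => by
    simp [Fin.prod_univ_two, pairFst, pairSnd]
  simp only [h]
  rw [← Fintype.prod_prod_type' fun (k : Fin (M / 2)) (r : Fin 2) => g ⟨2 * k + r, by omega⟩]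
  refine (Fintype.prod_of_injective
    (fun p : Fin (M / 2) × Fin 2 => (⟨2 * p.1 + p.2, by omega⟩ : Fin M)) ?_ _ _ ?_ fun _ => rfl).symm
  · rintro ⟨k, r⟩ ⟨k', r'⟩ h
    simp only [Fin.mk.injEq] at h
    ext
    · simp only
      omega
    · simp only
      omega
  · intro i hi
    refine hg i (not_lt.1 fun hlt => hi ⟨(⟨i / 2, hlt⟩, ⟨i % 2, by omega⟩), ?_⟩)
    ext
    simp only
    omega

theorem prod_sub_mul_sub_nonneg (x y : ℤ) (hxy : 0 ≤ x * y) :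
    ∀ (n : ℕ) (u : ℕ → ℤ), (∀ k < n / 2, u (2 * k) + u (2 * k + 1) = x + y) →
      u (2 * (n / 2)) = 0 → 0 ≤ ∏ j : Fin n, (x - u j) * (y - u j)
  | 0, _, _, _ => by simp
  | 1, u, _, h0 => by
    have h0 : u 0 = 0 := by simpa using h0
    simpa [h0] using hxy
  | n + 2, u, hu, h0 => by
    have hn : (n + 2) / 2 = n / 2 + 1 := by omega
    rw [hn] at hu h0
    have ih := prod_sub_mul_sub_nonneg x y hxy n (fun i => u (i + 2))
      (fun k hk => hu (k + 1) (by omega)) h0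
    have h1 : u 0 + u 1 = x + y := hu 0 (by omega)
    rw [Fin.prod_univ_succ, Fin.prod_univ_succ, ← mul_assoc]
    refine mul_nonneg ?_ (by simpa [add_assoc] using ih)
    simp only [Fin.val_zero, Fin.val_succ, zero_add]
    rw [show u 1 = x + y - u 0 by linarith]
    nlinarith [sq_nonneg ((x - u 0) * (y - u 0))]

theorem prod_sub_mul_prod_nonneg (D : ℤ) :
    ∀ (n : ℕ) (u d : ℕ → ℤ), (∀ i, 0 ≤ u i) → (∀ k < n / 2, u (2 * k) + u (2 * k + 1) = D) →
      u (2 * (n / 2)) = 0 → (∀ k < n / 2, 0 ≤ (u (2 * k) - u (2 * k + 1)) * d k) →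
      0 ≤ (∏ i : Fin n, ∏ j ∈ Ioi i, (u i - u j)) * ∏ k ∈ range (n / 2), d k
  | 0, _, _, _, _, _, _ => by simp
  | 1, _, _, _, _, _, _ => by simp
  | n + 2, u, d, hp, hu, h0, hd => by
    have hn : (n + 2) / 2 = n / 2 + 1 := by omega
    rw [hn] at hu h0 hd ⊢
    have ih := prod_sub_mul_prod_nonneg D n (fun i => u (i + 2)) (fun k => d (k + 1))
      (fun i => hp _) (fun k hk => hu (k + 1) (by omega)) h0 fun k hk => hd (k + 1) (by omega)
    have h1 := prod_sub_mul_sub_nonneg (u 0) (u 1) (mul_nonneg (hp 0) (hp 1)) n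
      (fun i => u (i + 2)) (fun k hk => (hu (k + 1) (by omega)).trans (hu 0 (by omega)).symm) h0
    have h2 : 0 ≤ (u 0 - u 1) * d 0 := hd 0 (by omega)
    refine (mul_nonneg (mul_nonneg h2 h1) ih).trans_eq ?_
    rw [Fin.prod_univ_succ, Fin.prod_univ_succ, prod_range_succ']
    simp only [Fin.prod_Ioi_zero, Fin.prod_Ioi_succ, Fin.prod_univ_succ (n := n), Fin.val_succ,
      Fin.val_zero, zero_add, prod_mul_distrib, add_assoc, one_add_one_eq_two]
    ring

open MvPolynomial in
theorem coeff_eq_zero_of_mem_span_X_pow {σ : Type*} (M : ℕ) {p : MvPolynomial σ ℤ}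
    (hp : p ∈ Ideal.span (Set.range fun i => (X i : MvPolynomial σ ℤ) ^ M)) {s : σ →₀ ℕ}
    (hs : ∀ i, s i < M) : coeff s p = 0 := by
  have h : (Set.range fun i => (X i : MvPolynomial σ ℤ) ^ M) =
      (fun s => monomial s (1 : ℤ)) '' Set.range fun i => Finsupp.single i M := by
    rw [← Set.range_comp]
    simp [X_pow_eq_monomial, Function.comp_def]
  rw [h, mem_ideal_span_monomial_image] at hp
  by_contra hne
  obtain ⟨_, ⟨i, rfl⟩, hi⟩ := hp s (mem_support_iff.2 hne)
  have := hi i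
  simp only [Finsupp.single_eq_same] at this
  exact absurd this (not_le.2 (hs i))

theorem det_vandermonde_mul_prod_pairs {R : Type} [CommRing R] {n : ℕ} (c : ℕ → ℤ)
    (hc : ∀ (R : Type) [CommRing R] (x y : R),
      (x - y) * quadQuot (x + y) x y n * (x + y) ^ (n % 2) =
        (x * y) ^ (n % 2) * oddDiffSum ((n + 2) / 2) c x y)
    (x : Fin (n + 2) → R) (hx : ∀ i, x i ^ (n + 2) = 0) (s : Finset (Fin ((n + 2) / 2))) :
    (Matrix.vandermonde x).det * ∏ k ∈ s,
      ((∏ i ∈ pairCompl k, (x (pairFst k) + x (pairSnd k) + x i)) *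
        (x (pairFst k) - x (pairSnd k)) * (x (pairFst k) + x (pairSnd k)) ^ (n % 2)) =
    (Matrix.vandermonde x).det * ∏ k ∈ s, ((x (pairFst k) * x (pairSnd k)) ^ (n % 2) *
        oddDiffSum ((n + 2) / 2) c (x (pairFst k)) (x (pairSnd k))) := by
  induction s using Finset.induction_on with
  | empty => simp
  | insert k s hk ih =>
    rw [prod_insert hk, prod_insert hk, ← hc]
    have h := det_vandermonde_mul_prod_erase_pair x hx (pairFst_ne_pairSnd k)
      (x (pairFst k) + x (pairSnd k))
    simp only [pairCompl] at ih ⊢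
    linear_combination (∏ i ∈ (univ.erase (pairFst k)).erase (pairSnd k),
      (x (pairFst k) + x (pairSnd k) + x i)) *
        (x (pairFst k) - x (pairSnd k)) * (x (pairFst k) + x (pairSnd k)) ^ (n % 2) * ih +
      (x (pairFst k) - x (pairSnd k)) * (x (pairFst k) + x (pairSnd k)) ^ (n % 2) *
      (∏ k ∈ s, ((x (pairFst k) * x (pairSnd k)) ^ (n % 2) *
        oddDiffSum ((n + 2) / 2) c (x (pairFst k)) (x (pairSnd k)))) * h

end Coefficient

section Expansion

/-- The larger (for `false`) or smaller exponent in the `j`-th term of `oddDiffSum m`. -/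
def pairExp (m ε j : ℕ) (b : Bool) : ℕ := (if b then j else 2 * m - 1 - j) + ε

/-- The coefficient of the monomial chosen by `t` in `oddDiffSum m c`. -/
def pairCoeff {m : ℕ} (c : ℕ → ℤ) (t : Fin m × Bool) : ℤ := if t.2 then -c t.1 else c t.1

/-- The exponents of the monomial selected by a choice of one term in each pair factor. -/
def choiceExp {m : ℕ} (ε : ℕ) (τ : Fin m → Fin m × Bool) (i : ℕ) : ℕ :=
  if h : i / 2 < m then
    if i % 2 = 0 then pairExp m ε (τ ⟨i / 2, h⟩).1 (τ ⟨i / 2, h⟩).2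
    else pairExp m ε (τ ⟨i / 2, h⟩).1 (!(τ ⟨i / 2, h⟩).2)
  else 0

theorem choiceExp_fst {m : ℕ} (ε : ℕ) (τ : Fin m → Fin m × Bool) (k : Fin m) :
    choiceExp ε τ (2 * k) = pairExp m ε (τ k).1 (τ k).2 := by
  simp [choiceExp]

theorem choiceExp_snd {m : ℕ} (ε : ℕ) (τ : Fin m → Fin m × Bool) (k : Fin m) :
    choiceExp ε τ (2 * k + 1) = pairExp m ε (τ k).1 (!(τ k).2) := by
  have h : (2 * (k : ℕ) + 1) / 2 = k := by omega
  simp [choiceExp, h, Nat.add_mod]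

theorem choiceExp_of_le {m : ℕ} (ε : ℕ) (τ : Fin m → Fin m × Bool) {i : ℕ} (hi : m ≤ i / 2) :
    choiceExp ε τ i = 0 := by
  simp [choiceExp, not_lt.2 hi]

theorem mul_oddDiffSum_eq_sum {R : Type*} [CommRing R] (m ε : ℕ) (c : ℕ → ℤ) (x y : R) :
    (x * y) ^ ε * oddDiffSum m c x y = ∑ t : Fin m × Bool,
      (pairCoeff c t : R) * (x ^ pairExp m ε t.1 t.2 * y ^ pairExp m ε t.1 (!t.2)) := by
  rw [Fintype.sum_prod_type, oddDiffSum, mul_sum, sum_range]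
  refine sum_congr rfl fun j _ => ?_
  have h : 2 * m - 1 - (j : ℕ) = 2 * (m - 1 - j) + 1 + j := by omega
  simp only [Fintype.sum_bool, pairCoeff, pairExp, h]
  simp
  ring

open MvPolynomial in
theorem prod_mul_oddDiffSum_eq_sum (M ε : ℕ) (c : ℕ → ℤ) :
    ∏ k : Fin (M / 2), (((X (pairFst k) * X (pairSnd k)) ^ ε *
        oddDiffSum (M / 2) c (X (pairFst k)) (X (pairSnd k)) : MvPolynomial (Fin M) ℤ)) =
      ∑ τ : Fin (M / 2) → Fin (M / 2) × Bool, monomial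
        (Finsupp.equivFunOnFinite.symm fun i : Fin M => choiceExp ε τ i)
        (∏ k, pairCoeff c (τ k)) := by
  simp only [mul_oddDiffSum_eq_sum]
  rw [prod_univ_sum, Fintype.piFinset_univ]
  refine sum_congr rfl fun τ _ => ?_
  rw [monomial_eq, Finsupp.prod_fintype _ _ (by simp), prod_mul_distrib, map_prod,
    prod_eq_prod_pairs fun i : Fin M => X i ^ _]
  · congr 1
    simp [pairFst, pairSnd, choiceExp_fst, choiceExp_snd]
  · intro i hi
    simp [choiceExp_of_le ε τ hi]

open MvPolynomial in
theorem coeff_det_vandermonde_mul_monomial {M : ℕ} (s u : Fin M →₀ ℕ) (d : ℤ) :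
    coeff s ((Matrix.vandermonde (X : Fin M → MvPolynomial (Fin M) ℤ)).det * monomial u d) =
      ∑ σ : Equiv.Perm (Fin M), if ∀ i : Fin M, (i : ℕ) + u (σ i) = s (σ i) then
        (Equiv.Perm.sign σ : ℤ) * d else 0 := by
  rw [Matrix.det_apply', sum_mul, coeff_sum]
  refine sum_congr rfl fun σ _ => ?_
  have h : ∏ i, Matrix.vandermonde (X : Fin M → MvPolynomial (Fin M) ℤ) (σ i) i =
      monomial (Finsupp.equivFunOnFinite.symm fun i : Fin M => ((σ.symm i : Fin M) : ℕ)) 1 := by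
    rw [monomial_eq, Finsupp.prod_fintype _ _ (by simp),
      ← Equiv.prod_comp σ fun i => X i ^ _]
    simp [Matrix.vandermonde_apply]
  have h' : ((Equiv.Perm.sign σ : ℤ) : MvPolynomial (Fin M) ℤ) = C (Equiv.Perm.sign σ : ℤ) := by
    simp
  rw [h, h', mul_assoc, monomial_mul, one_mul, C_mul_monomial, coeff_monomial]
  refine if_congr ?_ rfl rfl
  rw [Finsupp.ext_iff, ← σ.forall_congr_right]
  simp

theorem sign_mul_nonneg {M : ℕ} (u : ℕ → ℕ) (P : ℤ)
    (h : 0 ≤ (∏ i : Fin M, ∏ j ∈ Ioi i, ((u i : ℤ) - u j)) * P) (σ : Equiv.Perm (Fin M))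
    (hσ : ∀ i : Fin M, (i : ℕ) + u (σ i) = M - 1) : 0 ≤ (Equiv.Perm.sign σ : ℤ) * P := by
  have h1 := Matrix.det_permute σ (Matrix.vandermonde fun i : Fin M => -(u i : ℤ))
  have h2 : (Matrix.vandermonde fun i : Fin M => -(u i : ℤ)).submatrix σ id =
      Matrix.vandermonde fun i : Fin M => ((i : ℕ) : ℤ) - (M - 1 : ℕ) := by
    ext i j
    rw [Matrix.submatrix_apply, Matrix.vandermonde_apply, Matrix.vandermonde_apply, ← hσ i]
    push_cast
    simp
  rw [h2, Matrix.det_vandermonde, Matrix.det_vandermonde] at h1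
  have h3 : 0 < ∏ i : Fin M, ∏ j ∈ Ioi i, (((j : ℕ) : ℤ) - (M - 1 : ℕ) -
      (((i : ℕ) : ℤ) - (M - 1 : ℕ))) := prod_pos fun i _ => prod_pos fun j hj => by
    have := Fin.lt_def.1 (mem_Ioi.1 hj)
    omega
  simp only [neg_sub_neg] at h1
  rw [h1] at h3
  rcases Int.units_eq_one_or (Equiv.Perm.sign σ) with hs | hs
  · simp only [hs, Units.val_one, Int.cast_one, one_mul] at h3 ⊢
    exact nonneg_of_mul_nonneg_right h h3
  · simp only [hs, Units.val_neg, Units.val_one, Int.cast_neg, Int.cast_one] at h3 ⊢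
    nlinarith

/-- The exponents obtained by choosing the `k`-th term in the `k`-th factor are a permutation. -/
theorem exists_perm_add_choiceExp (M : ℕ) : ∃ σ : Equiv.Perm (Fin M), ∀ i : Fin M,
    (i : ℕ) + choiceExp (M % 2) (fun k : Fin (M / 2) => (k, false)) (σ i) = M - 1 := by
  set u := choiceExp (M % 2) fun k : Fin (M / 2) => (k, false) with hu
  have hval : ∀ i : ℕ, u i = if i / 2 < M / 2 then
      (if i % 2 = 0 then M - 1 - i / 2 else i / 2 + M % 2) else 0 := fun i => by
    simp only [hu, choiceExp, pairExp]
    split_ifs <;> simp at *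
    all_goals omega
  have hlt : ∀ i : Fin M, M - 1 - u i < M := fun i => by
    have := i.2
    omega
  have hle : ∀ i : Fin M, u i ≤ M - 1 := fun i => by
    rw [hval]
    split_ifs <;> omega
  have hinj : Function.Injective fun i : Fin M => (⟨M - 1 - u i, hlt i⟩ : Fin M) := by
    intro i j hij
    have hi := hle i
    have hj := hle j
    have h : u i = u j := by
      simp only [Fin.mk.injEq] at hij
      omega
    rw [hval, hval] at h
    ext
    split_ifs at h <;> omega
  refine ⟨(Equiv.ofBijective _ (Finite.injective_iff_bijective.1 hinj)).symm, fun i => ?_⟩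
  have h := congrArg Fin.val
    ((Equiv.ofBijective _ (Finite.injective_iff_bijective.1 hinj)).apply_symm_apply i)
  simp only [Equiv.ofBijective_apply] at h
  have := hle ((Equiv.ofBijective _ (Finite.injective_iff_bijective.1 hinj)).symm i)
  omega

theorem prod_choiceExp_mul_prod_pairCoeff_nonneg {M : ℕ} (c : ℕ → ℤ) (hc : ∀ j < M / 2, 1 ≤ c j)
    (τ : Fin (M / 2) → Fin (M / 2) × Bool) :
    0 ≤ (∏ i : Fin M, ∏ j ∈ Ioi i,
      ((choiceExp (M % 2) τ i : ℤ) - choiceExp (M % 2) τ j)) * ∏ k, pairCoeff c (τ k) := by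
  have h := prod_sub_mul_prod_nonneg (2 * (M / 2 : ℕ) - 1 + 2 * (M % 2 : ℕ)) M
    (fun i => choiceExp (M % 2) τ i)
    (fun k => if h : k < M / 2 then pairCoeff c (τ ⟨k, h⟩) else 1) (fun i => by positivity)
    (fun k hk => ?_) ?_ fun k hk => ?_
  · simpa [prod_range] using h
  · have h1 := choiceExp_fst (M % 2) τ ⟨k, hk⟩
    have h2 := choiceExp_snd (M % 2) τ ⟨k, hk⟩
    simp only at h1 h2
    simp only [h1, h2, pairExp]
    have := (τ ⟨k, hk⟩).1.2
    cases (τ ⟨k, hk⟩).2 <;> simp <;> omega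
  · simp [choiceExp_of_le]
  · have h1 := choiceExp_fst (M % 2) τ ⟨k, hk⟩
    have h2 := choiceExp_snd (M % 2) τ ⟨k, hk⟩
    simp only at h1 h2
    simp only [h1, h2, pairExp, hk, dif_pos, pairCoeff]
    have hlt := (τ ⟨k, hk⟩).1.2
    have := hc _ hlt
    cases (τ ⟨k, hk⟩).2
    · refine mul_nonneg ?_ ?_ <;> simp <;> omega
    · refine mul_nonneg_of_nonpos_of_nonpos ?_ ?_ <;> simp <;> omega

open MvPolynomial in
theorem coeff_prod_pair_forms_ne_zero {n : ℕ} (hn : 3 ≤ n) :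
    coeff (Finsupp.equivFunOnFinite.symm fun _ : Fin (n + 2) => n + 1)
      ((Matrix.vandermonde (X : Fin (n + 2) → MvPolynomial (Fin (n + 2)) ℤ)).det *
        ∏ k, ((∏ i ∈ pairCompl k, (X (pairFst k) + X (pairSnd k) + X i)) *
          (X (pairFst k) - X (pairSnd k)) * (X (pairFst k) + X (pairSnd k)) ^ (n % 2))) ≠ 0 := by
  obtain ⟨c, hc1, hc2⟩ := exists_pair_factor hn
  let I : Ideal (MvPolynomial (Fin (n + 2)) ℤ) :=
    Ideal.span (Set.range fun i => (X i : MvPolynomial (Fin (n + 2)) ℤ) ^ (n + 2))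
  have h1 := det_vandermonde_mul_prod_pairs c hc2 (fun i => Ideal.Quotient.mk I (X i))
    (fun i => by
      rw [← map_pow, Ideal.Quotient.eq_zero_iff_mem]
      exact Ideal.subset_span ⟨i, rfl⟩) univ
  have hodd : ∀ x y : MvPolynomial (Fin (n + 2)) ℤ, Ideal.Quotient.mk I
      (oddDiffSum ((n + 2) / 2) c x y) = oddDiffSum ((n + 2) / 2) c
        (Ideal.Quotient.mk I x) (Ideal.Quotient.mk I y) := fun x y => by
    simp [oddDiffSum]
  have hdet : (Matrix.vandermonde fun i => Ideal.Quotient.mk I (X i)).det = Ideal.Quotient.mk I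
      (Matrix.vandermonde (X : Fin (n + 2) → MvPolynomial (Fin (n + 2)) ℤ)).det := by
    simp [Matrix.det_vandermonde]
  simp only [hdet, ← hodd, ← map_mul, ← map_add, ← map_sub, ← map_pow, ← map_prod] at h1
  have h2 := coeff_eq_zero_of_mem_span_X_pow (n + 2) (Ideal.Quotient.eq.1 h1)
    (s := Finsupp.equivFunOnFinite.symm fun _ : Fin (n + 2) => n + 1) (by simp)
  rw [coeff_sub, sub_eq_zero] at h2
  rw [h2, prod_mul_oddDiffSum_eq_sum, mul_sum, coeff_sum]
  simp only [coeff_det_vandermonde_mul_monomial, Finsupp.equivFunOnFinite_symm_apply_apply]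
  have hmod : (n + 2) % 2 = n % 2 := by omega
  refine ne_of_gt ?_
  have hnn : ∀ (τ : Fin ((n + 2) / 2) → Fin ((n + 2) / 2) × Bool) (σ : Equiv.Perm (Fin (n + 2))),
      0 ≤ if ∀ i : Fin (n + 2), (i : ℕ) + choiceExp (n % 2) τ (σ i) = n + 1 then
        (Equiv.Perm.sign σ : ℤ) * ∏ k, pairCoeff c (τ k) else 0 := fun τ σ => by
    split_ifs with h
    · refine sign_mul_nonneg (choiceExp (n % 2) τ) _ ?_ σ h
      rw [← hmod]
      exact prod_choiceExp_mul_prod_pairCoeff_nonneg c hc1 τ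
    · exact le_rfl
  obtain ⟨σ, hσ⟩ := exists_perm_add_choiceExp (n + 2)
  rw [hmod] at hσ
  refine sum_pos' (fun τ _ => sum_nonneg fun σ _ => hnn τ σ) ⟨fun k => (k, false), mem_univ _,
    sum_pos' (fun σ _ => hnn _ σ) ⟨σ, mem_univ _, lt_of_le_of_ne (hnn _ σ) ?_⟩⟩
  have hσ' : ∀ i : Fin (n + 2), (i : ℕ) + choiceExp (n % 2)
      (fun k : Fin ((n + 2) / 2) => (k, false)) (σ i) = n + 1 := hσ
  rw [if_pos hσ']
  refine (mul_ne_zero (by simp) (prod_ne_zero_iff.2 fun k _ => ?_)).symm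
  have := hc1 k k.2
  simp only [pairCoeff]
  simp
  omega

end Expansion

section Wedge

variable {M : ℕ}

/-- Expansion of an alternating map on combinations of a family `e`, symmetrized. -/
theorem factorial_smul_alternatingMap_sum {E F ι : Type*} [Fintype ι] [AddCommGroup E]
    [Module ℂ E] [AddCommGroup F] [Module ℂ F] {N : ℕ} (g : E [⋀^Fin N]→ₗ[ℂ] F) (e : ι → E)
    (B : ι → Fin N → ℂ) :
    (N.factorial : ℂ) • g (fun t => ∑ p, B p t • e p) =
      ∑ q : Fin N → ι, (Matrix.of fun s t => B (q s) t).det • g (fun t => e (q t)) := by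
  classical
  have h : ∀ σ : Equiv.Perm (Fin N), g (fun t => ∑ p, B p t • e p) =
      ∑ q : Fin N → ι, (((Equiv.Perm.sign σ : ℤ) : ℂ) * ∏ t, B (q (σ t)) t) •
        g (fun t => e (q t)) := fun σ => by
    have h1 : g (fun t => ∑ p, B p t • e p) = ∑ q : Fin N → ι, g (fun t => B (q t) t • e (q t)) :=
      g.toMultilinearMap.map_sum _
    rw [h1, ← (Equiv.arrowCongr σ.symm (Equiv.refl ι)).sum_comp]
    refine sum_congr rfl fun q _ => ?_
    have h2 := g.toMultilinearMap.map_smul_univ (fun t => B (q (σ t)) t) fun t => e (q (σ t))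
    have h3 := g.map_perm (fun t => e (q t)) σ
    simp only [AlternatingMap.coe_multilinearMap] at h2
    simp only [Function.comp_def] at h3
    simp only [Equiv.arrowCongr_apply, Equiv.symm_symm, Equiv.coe_refl, Function.comp_apply, id]
    rw [h2, h3, mul_comm, mul_smul, Units.smul_def, ← Int.cast_smul_eq_zsmul ℂ]
  have hc : (N.factorial : ℂ) • g (fun t => ∑ p, B p t • e p) =
      ∑ _σ : Equiv.Perm (Fin N), g (fun t => ∑ p, B p t • e p) := by
    rw [sum_const, card_univ, Fintype.card_perm, Fintype.card_fin, Nat.cast_smul_eq_nsmul]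
  rw [hc, sum_congr rfl fun σ _ => h σ, sum_comm]
  refine sum_congr rfl fun q _ => ?_
  rw [← sum_smul, Matrix.det_apply']
  rfl

/-- A trivector `ψ` has an alternating coefficient form, giving the coordinates of the images of
`ψ` under linear maps. -/
theorem exists_coefficient_form (ψ : ExteriorAlgebra ℂ (V M)) (hψ : ψ ∈ ⋀[ℂ]^3 (V M)) :
    ∃ T : (Fin M → ℂ) [⋀^Fin 3]→ₗ[ℂ] ℂ, ContDiff ℝ 3 (fun u : Fin 3 → Fin M → ℂ => T u) ∧
      ∀ (L : V M →ₗ[ℂ] V M) (f : Fin M → Fin M → ℂ), (∀ v p, L v p = ∑ j, f p j * v j) →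
        (6 : ℂ) • ExteriorAlgebra.map L ψ = ∑ q : Fin 3 → Fin M, T (fun s => f (q s)) •
          ιMulti ℂ 3 fun t => (EuclideanSpace.single (q t) 1 : V M) := by
  rw [← ιMulti_span_fixedDegree] at hψ
  induction hψ using Submodule.span_induction with
  | mem x hx =>
    obtain ⟨v, rfl⟩ := hx
    let P : (Fin M → ℂ) →ₗ[ℂ] (Fin 3 → ℂ) :=
      { toFun := fun u t => ∑ j, u j * v t j
        map_add' := fun a b => by ext; simp [add_mul, sum_add_distrib]
        map_smul' := fun a b => by ext; simp [mul_sum, mul_assoc] }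
    have hT : ∀ u : Fin 3 → Fin M → ℂ, (Matrix.detRowAlternating.compLinearMap P) u =
        (Matrix.of fun s t => ∑ j, u s j * v t j).det := fun u => rfl
    refine ⟨Matrix.detRowAlternating.compLinearMap P, ?_, fun L f hL => ?_⟩
    · simp only [hT, Matrix.det_apply', Matrix.of_apply]
      fun_prop
    · have h := factorial_smul_alternatingMap_sum (ιMulti ℂ 3)
        (fun p : Fin M => (EuclideanSpace.single p 1 : V M)) fun p t => ∑ j, f p j * v t j
      have h6 : ((Nat.factorial 3 : ℕ) : ℂ) = 6 := by norm_num [Nat.factorial]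
      rw [h6] at h
      simp only [hT]
      rw [← h, map_apply_ιMulti]
      congr 2
      ext t p
      simp [hL, Pi.single_apply]
  | zero => exact ⟨0, by simpa using contDiff_const, by simp⟩
  | add x y _ _ hx hy =>
    obtain ⟨T, h1, h2⟩ := hx
    obtain ⟨T', h1', h2'⟩ := hy
    refine ⟨T + T', h1.add h1', fun L f hL => ?_⟩
    simp [h2 L f hL, h2' L f hL, add_smul, sum_add_distrib]
  | smul a x _ hx =>
    obtain ⟨T, h1, h2⟩ := hx
    refine ⟨a • T, h1.const_smul a, fun L f hL => ?_⟩
    rw [map_smul, smul_comm, h2 L f hL]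
    simp [smul_sum, mul_smul]

theorem ιMulti_single_mem_SOV (q : Fin 3 → Fin M)
    (hq : ∀ j k, j ≠ k → (q j : ℕ) / 2 ≠ (q k : ℕ) / 2) :
    (ιMulti ℂ 3 fun t => (EuclideanSpace.single (q t) 1 : V M)) ∈ SOV M 3 := by
  have hinj : Function.Injective q := fun j k h => by
    by_contra hne
    exact hq j k hne (by rw [h])
  have h := (ιMulti ℂ 3).map_perm (fun t => (EuclideanSpace.single (q t) 1 : V M)) (Tuple.sort q)
  have hw : wedge M 3 (fun j => (q (Tuple.sort q j) : ℕ) + 1) ∈ SOV M 3 := by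
    refine Submodule.subset_span ⟨_, ⟨fun j k hjk => ?_, fun j => ⟨by omega, by omega⟩⟩, ?_, rfl⟩
    · have h1 := (Tuple.monotone_sort q).strictMono_of_injective
        (hinj.comp (Tuple.sort q).injective) hjk
      exact Nat.succ_lt_succ h1
    · intro j k hjk
      have := hq (Tuple.sort q j) (Tuple.sort q k) ((Tuple.sort q).injective.ne hjk)
      dsimp only
      omega
  have he : wedge M 3 (fun j => (q (Tuple.sort q j) : ℕ) + 1) =
      ιMulti ℂ 3 ((fun t => (EuclideanSpace.single (q t) 1 : V M)) ∘ Tuple.sort q) := by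
    rw [wedge]
    congr 1
    ext1 j
    have hj := (q (Tuple.sort q j)).2
    rw [stdVec, dif_pos ⟨by omega, by omega⟩]
    rfl
  rw [he, h] at hw
  rcases Int.units_eq_one_or (Equiv.Perm.sign (Tuple.sort q)) with hs | hs
  · simpa [hs] using hw
  · simpa [hs] using hw

theorem alternatingMap_eq_zero_of_same_pair {E : Type*} [AddCommGroup E] [Module ℂ E]
    (T : E [⋀^Fin 3]→ₗ[ℂ] ℂ) (f : Fin M → E)
    (hf : ∀ (k : Fin (M / 2)), ∀ i ∈ pairCompl k, T ![f (pairFst k), f (pairSnd k), f i] = 0)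
    (q : Fin 3 → Fin M) {j k : Fin 3} (hjk : j ≠ k) (h : (q j : ℕ) / 2 = (q k : ℕ) / 2) :
    T (fun s => f (q s)) = 0 := by
  by_cases hinj : Function.Injective q
  · wlog hlt : q j < q k generalizing j k
    · exact this hjk.symm h.symm (lt_of_le_of_ne (not_lt.1 hlt) (hinj.ne hjk.symm))
    have hσ : ∀ j k : Fin 3, j ≠ k → ∃ σ : Equiv.Perm (Fin 3), σ 0 = j ∧ σ 1 = k := by decide
    obtain ⟨σ, rfl, rfl⟩ := hσ j k hjk
    have hlt' := Fin.lt_def.1 hlt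
    have hK : (q (σ 0) : ℕ) / 2 < M / 2 := by omega
    have ha : q (σ 0) = pairFst ⟨_, hK⟩ := by
      ext
      simp only [pairFst]
      omega
    have hb : q (σ 1) = pairSnd ⟨_, hK⟩ := by
      ext
      simp only [pairSnd]
      omega
    have hc : q (σ 2) ∈ pairCompl ⟨_, hK⟩ := by
      rw [pairCompl, ← ha, ← hb]
      simp [hinj.eq_iff]
    have h0 := hf _ _ hc
    rw [← ha, ← hb] at h0
    have h1 := T.map_perm (fun s => f (q s)) σ
    have h2 : (fun s => f (q s)) ∘ σ = ![f (q (σ 0)), f (q (σ 1)), f (q (σ 2))] := by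
      ext1 s
      fin_cases s <;> rfl
    rw [h2, h0] at h1
    rcases Int.units_eq_one_or (Equiv.Perm.sign σ) with hs | hs
    · simpa [hs] using h1.symm
    · simpa [hs] using h1.symm
  · simp only [Function.Injective, not_forall] at hinj
    obtain ⟨s, t, hst, hne⟩ := hinj
    exact T.map_eq_zero_of_eq _ (by rw [hst]) hne

end Wedge

section Sections

/-- The unitary operator whose matrix has the normalized rows `f p`. -/
theorem exists_unitary_of_orthogonal {M : ℕ} (f : Fin M → Fin M → ℂ) (h0 : ∀ i, f i ≠ 0)
    (hf : ∀ i j, i < j → ∑ l, starRingEnd ℂ (f i l) * f j l = 0) :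
    ∃ (U : V M ≃ₗᵢ[ℂ] V M) (r : Fin M → ℂ), ∀ v p, U v p = ∑ j, (r p • f p) j * v j := by
  let b : Fin M → V M := fun p => WithLp.toLp 2 fun l => starRingEnd ℂ (f p l)
  have hb : ∀ i, b i ≠ 0 := fun i hi => h0 i (by
    ext l
    have := congrArg (fun v : V M => v l) hi
    simpa [b] using this)
  have hne : ∀ i j, i ≠ j → inner ℂ (b i) (b j) = 0 := by
    have hlt : ∀ i j, i < j → inner ℂ (b j) (b i) = 0 := fun i j hij => by
      rw [← hf i j hij]
      simp [b, PiLp.inner_apply]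
    intro i j hij
    rcases lt_or_gt_of_ne hij with h | h
    · rw [inner_eq_zero_symm]
      exact hlt i j h
    · exact hlt j i h
  have hon : Orthonormal ℂ fun p => ((‖b p‖⁻¹ : ℝ) : ℂ) • b p := by
    refine ⟨fun p => ?_, fun i j hij => ?_⟩
    · rw [norm_smul, Complex.norm_real, norm_inv, norm_norm,
        inv_mul_cancel₀ (norm_ne_zero_iff.2 (hb p))]
    · change inner ℂ (((‖b i‖⁻¹ : ℝ) : ℂ) • b i) (((‖b j‖⁻¹ : ℝ) : ℂ) • b j) = 0
      rw [inner_smul_left, inner_smul_right, hne i j hij]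
      simp
  let B : OrthonormalBasis (Fin M) ℂ (V M) := OrthonormalBasis.mk hon
    (hon.linearIndependent.span_eq_top_of_card_eq_finrank' (by simp)).ge
  refine ⟨B.repr, fun p => ((‖b p‖⁻¹ : ℝ) : ℂ), fun v p => ?_⟩
  rw [B.repr_apply_apply]
  simp only [B, OrthonormalBasis.coe_mk, PiLp.inner_apply]
  refine sum_congr rfl fun j _ => ?_
  simp [b]
  ring

/-- Index set of the equations: orthogonality of the rows, vanishing of the coefficients with an
occupied pair, and vacuous equations completing the degree count. -/
abbrev SectionIndex (n : ℕ) : Type :=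
  ((i : Fin (n + 2)) × { j // j ∈ Ioi i }) ⊕
    ((k : Fin ((n + 2) / 2)) × { i // i ∈ pairCompl k }) ⊕
      Fin ((n + 2) / 2) ⊕ Fin ((n + 2) / 2) × Fin (n % 2)

/-- The weights of the equations under the rescaling of the rows. -/
def sectionWeight {n : ℕ} : SectionIndex n → Fin (n + 2) → ℤ
  | .inl p => Pi.single p.2.1 1 - Pi.single p.1 1
  | .inr (.inl p) => Pi.single (pairFst p.1) 1 + Pi.single (pairSnd p.1) 1 + Pi.single p.2.1 1
  | .inr (.inr (.inl k)) => Pi.single (pairFst k) 1 - Pi.single (pairSnd k) 1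
  | .inr (.inr (.inr p)) => Pi.single (pairFst p.1) 1 + Pi.single (pairSnd p.1) 1

/-- The equations cutting out the orthogonal frames in which `T` is singly occupied. -/
def sectionValue {n : ℕ} (T : (Fin (n + 2) → ℂ) [⋀^Fin 3]→ₗ[ℂ] ℂ) :
    SectionIndex n → (Fin (n + 2) → Fin (n + 2) → ℂ) → ℂ
  | .inl p, f => ∑ l, starRingEnd ℂ (f p.1 l) * f p.2.1 l
  | .inr (.inl p), f => T ![f (pairFst p.1), f (pairSnd p.1), f p.2.1]
  | .inr (.inr _), _ => 0

open MvPolynomial in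
theorem coeff_prod_sectionWeight_ne_zero {n : ℕ} (hn : 3 ≤ n) :
    coeff (Finsupp.equivFunOnFinite.symm fun _ : Fin (n + 2) => n + 1)
      (∏ a : SectionIndex n, ∑ i, C (sectionWeight a i) * X i) ≠ 0 := by
  have hX : ∀ j : Fin (n + 2), ∑ i, C ((Pi.single j 1 : Fin (n + 2) → ℤ) i) * X i =
      (X j : MvPolynomial (Fin (n + 2)) ℤ) := fun j => by
    rw [sum_eq_single j (fun i _ hi => by simp [hi]) (by simp)]
    simp
  refine ne_of_eq_of_ne (congrArg _ ?_) (coeff_prod_pair_forms_ne_zero hn)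
  rw [Fintype.prod_sum_type, Fintype.prod_sum_type, Fintype.prod_sum_type, Fintype.prod_sigma,
    Fintype.prod_sigma, Fintype.prod_prod_type, Matrix.det_vandermonde, prod_mul_distrib,
    prod_mul_distrib, mul_assoc (∏ k, ∏ i ∈ pairCompl k, _)]
  simp only [sectionWeight, Pi.sub_apply, Pi.add_apply, map_sub, map_add, sub_mul, add_mul,
    sum_sub_distrib, sum_add_distrib, hX, prod_const, card_univ, Fintype.card_fin]
  refine congrArg₂ (· * ·) (prod_congr rfl fun i _ => ?_)
    (congrArg₂ (· * ·) (prod_congr rfl fun k _ => ?_) rfl)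
  · exact prod_coe_sort (Ioi i) fun j => (X j - X i : MvPolynomial (Fin (n + 2)) ℤ)
  · exact prod_coe_sort (pairCompl k) fun i =>
      (X (pairFst k) + X (pairSnd k) + X i : MvPolynomial (Fin (n + 2)) ℤ)

theorem sectionValue_update {n : ℕ} (T : (Fin (n + 2) → ℂ) [⋀^Fin 3]→ₗ[ℂ] ℂ)
    (a : SectionIndex n) (i : Fin (n + 2)) (f : Fin (n + 2) → Fin (n + 2) → ℂ) (z : ℂ)
    (hz : ‖z‖ = 1) : sectionValue T a (Function.update f i (z • f i)) =
      z ^ sectionWeight a i * sectionValue T a f := by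
  have hz0 : z ≠ 0 := by
    rintro rfl
    simp at hz
  have hu : ∀ q, Function.update f i (z • f i) q =
      z ^ (Pi.single q 1 : Fin (n + 2) → ℤ) i • f q := fun q => by
    by_cases h : i = q
    · subst h
      simp
    · simp [h, Ne.symm h]
  rcases a with p | p | p
  · have hconj : ∀ m : ℤ, starRingEnd ℂ (z ^ m) = z ^ (-m) := fun m => by
      rw [map_zpow₀, ← Complex.inv_eq_conj hz, inv_zpow, zpow_neg]
    simp only [sectionValue, sectionWeight, hu, mul_sum]
    refine sum_congr rfl fun l _ => ?_
    simp only [Pi.smul_apply, smul_eq_mul, map_mul, hconj, Pi.sub_apply]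
    rw [sub_eq_add_neg, zpow_add₀ hz0]
    ring
  · have h := T.toMultilinearMap.map_smul_univ
      (fun t => z ^ (Pi.single ((![pairFst p.1, pairSnd p.1, p.2.1] : Fin 3 → _) t) 1 :
        Fin (n + 2) → ℤ) i) ![f (pairFst p.1), f (pairSnd p.1), f p.2.1]
    have h1 : (fun t : Fin 3 => z ^ (Pi.single ((![pairFst p.1, pairSnd p.1, p.2.1] :
        Fin 3 → _) t) 1 : Fin (n + 2) → ℤ) i •
          (![f (pairFst p.1), f (pairSnd p.1), f p.2.1] : Fin 3 → _) t) =
        ![Function.update f i (z • f i) (pairFst p.1), Function.update f i (z • f i) (pairSnd p.1),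
          Function.update f i (z • f i) p.2.1] := by
      simp only [hu]
      ext1 t
      fin_cases t <;> rfl
    rw [h1] at h
    simp only [AlternatingMap.coe_multilinearMap] at h
    rw [sectionValue, h, sectionValue, sectionWeight, Fin.prod_univ_three, smul_eq_mul,
      Pi.add_apply, Pi.add_apply, zpow_add₀ hz0, zpow_add₀ hz0]
    rfl
  · simp [sectionValue]

theorem contDiff_sectionValue {n : ℕ} (T : (Fin (n + 2) → ℂ) [⋀^Fin 3]→ₗ[ℂ] ℂ)
    (hT : ContDiff ℝ 3 fun u : Fin 3 → Fin (n + 2) → ℂ => T u) (a : SectionIndex n) :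
    ContDiff ℝ 3 (sectionValue T a) := by
  rcases a with p | p | p
  · refine ContDiff.sum fun l _ => ContDiff.mul (Complex.conjCLE.contDiff.comp ?_) ?_
    · fun_prop
    · fun_prop
  · refine hT.comp (contDiff_pi.2 fun t => ?_)
    fin_cases t
    · exact contDiff_apply ℝ (Fin (n + 2) → ℂ) (pairFst p.1)
    · exact contDiff_apply ℝ (Fin (n + 2) → ℂ) (pairSnd p.1)
    · exact contDiff_apply ℝ (Fin (n + 2) → ℂ) p.2.1
  · exact contDiff_const

end Sections

/-- For `M ≥ 5` and `N = 3`, the single occupancy subspace is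
universal: every `ψ ∈ ⋀³ V` is LU-equivalent to a single occupancy vector. -/
theorem sov_universal_three_fermions (M : ℕ) (hM : 5 ≤ M)
    (ψ : ExteriorAlgebra ℂ (V M)) (hψ : ψ ∈ ⋀[ℂ]^3 (V M)) :
    ∃ U : V M ≃ₗᵢ[ℂ] V M, luMap M U ψ ∈ SOV M 3 := by
  obtain ⟨n, rfl⟩ : ∃ n, M = n + 2 := ⟨M - 2, by omega⟩
  obtain ⟨T, hTc, hT⟩ := exists_coefficient_form ψ hψ
  obtain ⟨f, hf0, hf⟩ := exists_common_zero (d := n + 1) (sectionValue T)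
    (contDiff_sectionValue T hTc) sectionWeight (sectionValue_update T)
    (coeff_prod_sectionWeight_ne_zero (by omega))
  obtain ⟨U, r, hU⟩ := exists_unitary_of_orthogonal f hf0 fun i j hij =>
    hf (.inl ⟨i, j, mem_Ioi.2 hij⟩)
  refine ⟨U, ?_⟩
  have h := hT U.toLinearEquiv.toLinearMap (fun p => r p • f p) hU
  have h6 : luMap (n + 2) U ψ = (6 : ℂ)⁻¹ • (6 : ℂ) • luMap (n + 2) U ψ := by
    rw [smul_smul, inv_mul_cancel₀ (by norm_num), one_smul]
  rw [h6]
  refine Submodule.smul_mem _ _ ?_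
  rw [luMap, h]
  refine Submodule.sum_mem _ fun q _ => ?_
  by_cases hq : ∀ j k, j ≠ k → (q j : ℕ) / 2 ≠ (q k : ℕ) / 2
  · exact Submodule.smul_mem _ _ (ιMulti_single_mem_SOV q hq)
  · push Not at hq
    obtain ⟨j, k, hjk, hq⟩ := hq
    have h0 := alternatingMap_eq_zero_of_same_pair T f
      (fun k i hi => hf (.inr (.inl ⟨k, i, hi⟩))) q hjk hq
    have h1 := T.toMultilinearMap.map_smul_univ (fun s => r (q s)) fun s => f (q s)
    simp only [AlternatingMap.coe_multilinearMap] at h1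
    rw [h1, h0, smul_zero, zero_smul]
    exact Submodule.zero_mem _
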